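/- Let X = (X_1,…,X_p)ᵀ and Y = (Y_1,…,Y_p)ᵀ be centered Gaussian vectors with covariance matrices Σ^X = (σ^X_{jk}) and Σ^Y = (σ^Y_{jk}), and let Δ := max_{1≤j,k≤p} |σ^X_{jk} − σ^Y_{jk}|. Suppose p ≥ 3 and σ^Y_{jj} > 0 for all 1 ≤ j ≤ p. Then there is a constant K depending only on min_{1≤j≤p} σ^Y_{jj} such that sup_{A ∈ 𝒜^{Re}} | P(X ∈ A) − P(Y ∈ A) | ≤ K · Δ^{1/3} · log^{2/3} p. -/

import Mathlib

open MeasureTheory ProbabilityTheory Filter Set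
open scoped ENNReal NNReal BigOperators Topology

noncomputable section

namespace AJDN

/-- `X` is a centered Gaussian random vector: it is measurable, its coordinates are
centered, and every linear combination of its coordinates is Gaussian. -/
def IsCenteredGaussianVec {Ω : Type*} [MeasurableSpace Ω] (μ : Measure Ω)
    {p : ℕ} (X : Ω → Fin p → ℝ) : Prop :=
  Measurable X ∧ (∀ j, ∫ ω, X ω j ∂μ = 0) ∧
    ∀ a : Fin p → ℝ, ∃ v : ℝ≥0,
      Measure.map (fun ω => ∑ j, a j * X ω j) μ = gaussianReal 0 v

lemma gaussianReal_real_eq_setIntegral (s : Set ℝ) :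
    (gaussianReal 0 1).real s = ∫ x in s, gaussianPDFReal 0 1 x := by
  rw [Measure.real, gaussianReal_apply_eq_integral 0 one_ne_zero,
    ENNReal.toReal_ofReal (integral_nonneg fun x => gaussianPDFReal_nonneg _ _ _)]

lemma gaussianReal_real_Ioc_le {a b M : ℝ} (hab : a ≤ b)
    (h : ∀ x ∈ Ioc a b, gaussianPDFReal 0 1 x ≤ M) :
    (gaussianReal 0 1).real (Ioc a b) ≤ M * (b - a) := by
  rw [gaussianReal_real_eq_setIntegral]
  refine (setIntegral_mono_on (integrable_gaussianPDFReal 0 1).integrableOn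
    (integrableOn_const (C := M) (by simp)) measurableSet_Ioc h).trans ?_
  simp [hab, mul_comm]

lemma le_gaussianReal_real_Ioc {a b M : ℝ} (hab : a ≤ b)
    (h : ∀ x ∈ Ioc a b, M ≤ gaussianPDFReal 0 1 x) :
    M * (b - a) ≤ (gaussianReal 0 1).real (Ioc a b) := by
  rw [gaussianReal_real_eq_setIntegral]
  refine le_trans ?_ (setIntegral_mono_on (integrableOn_const (C := M) (by simp))
    (integrable_gaussianPDFReal 0 1).integrableOn measurableSet_Ioc h)
  simp [hab, mul_comm]

lemma gaussianPDFReal_le_exp_mul {x y t : ℝ} (h : y ^ 2 ≤ x ^ 2 + 2 * t) :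
    gaussianPDFReal 0 1 x ≤ Real.exp t * gaussianPDFReal 0 1 y := by
  simp only [gaussianPDFReal, NNReal.coe_one, mul_one, sub_zero]
  rw [mul_left_comm, ← Real.exp_add]
  gcongr
  linarith

lemma gaussianPDFReal_le_exp (x : ℝ) : gaussianPDFReal 0 1 x ≤ Real.exp (-x ^ 2 / 2) := by
  simp only [gaussianPDFReal, NNReal.coe_one, mul_one, sub_zero]
  refine mul_le_of_le_one_left (Real.exp_pos _).le (inv_le_one_of_one_le₀ ?_)
  rw [Real.one_le_sqrt]
  linarith [Real.pi_gt_three]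

/-- A short interval below the level `L` carries a Gaussian mass controlled by the upper tail. -/
lemma gaussianReal_real_Ioc_le_mul_Ioi {c δ L : ℝ} (hL : 1 ≤ L) (hδ : 0 ≤ δ)
    (hδL : (1 + L) * δ ≤ 1) (hc : c + δ ≤ L) :
    (gaussianReal 0 1).real (Ioc c (c + δ)) ≤
      Real.exp 2 * (1 + L) * δ * (gaussianReal 0 1).real (Ioi (c + δ)) := by
  set y := c + δ with hy
  set r := 1 / (1 + L) with hr
  have hL0 : 0 < 1 + L := by linarith
  have hr0 : 0 < r := by positivity
  have hrL : (1 + L) * r = 1 := by rw [hr]; field_simp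
  have hup : (gaussianReal 0 1).real (Ioc c y) ≤ (Real.exp 1 * gaussianPDFReal 0 1 y) * (y - c) := by
    refine gaussianReal_real_Ioc_le (by linarith) fun x hx => gaussianPDFReal_le_exp_mul ?_
    have h1 : 0 ≤ y - x := by linarith [hx.2]
    have h2 : y - x ≤ δ := by linarith [hx.1]
    nlinarith [mul_nonneg h1 (by linarith : 0 ≤ L - y), mul_nonneg h1 h1]
  have hlow : (Real.exp (-1) * gaussianPDFReal 0 1 y) * ((y + r) - y) ≤
      (gaussianReal 0 1).real (Ioc y (y + r)) := by
    refine le_gaussianReal_real_Ioc (by linarith) fun z hz => ?_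
    have h1 : 0 ≤ z - y := by linarith [hz.1]
    have h2 : z - y ≤ r := by linarith [hz.2]
    have h3 : gaussianPDFReal 0 1 y ≤ Real.exp 1 * gaussianPDFReal 0 1 z :=
      gaussianPDFReal_le_exp_mul (by
        have h4 : r ≤ 1 := by
          rw [hr, div_le_one hL0]; linarith
        nlinarith [mul_nonneg h1 (by linarith : 0 ≤ L - y)])
    calc Real.exp (-1) * gaussianPDFReal 0 1 y
        ≤ Real.exp (-1) * (Real.exp 1 * gaussianPDFReal 0 1 z) := by gcongr
      _ = gaussianPDFReal 0 1 z := by rw [← mul_assoc, ← Real.exp_add]; simp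
  have hmono : (gaussianReal 0 1).real (Ioc y (y + r)) ≤ (gaussianReal 0 1).real (Ioi y) :=
    measureReal_mono Ioc_subset_Ioi_self
  have he : Real.exp 2 * Real.exp (-1) = Real.exp 1 := by rw [← Real.exp_add]; norm_num
  calc (gaussianReal 0 1).real (Ioc c y)
      ≤ (Real.exp 1 * gaussianPDFReal 0 1 y) * (y - c) := hup
    _ = Real.exp 2 * ((1 + L) * r) * δ * (Real.exp (-1) * gaussianPDFReal 0 1 y) := by
        rw [hrL, ← he, show y - c = δ by rw [hy]; ring]; ring
    _ = Real.exp 2 * (1 + L) * δ * ((Real.exp (-1) * gaussianPDFReal 0 1 y) * ((y + r) - y)) := by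
        ring
    _ ≤ _ := by gcongr; exact hlow.trans hmono

lemma gaussianReal_real_Ioc_le_exp_neg {c δ L : ℝ} (hL : 1 ≤ L) (hδ : 0 ≤ δ)
    (hδL : (1 + L) * δ ≤ 1) (hc : L < c + δ) :
    (gaussianReal 0 1).real (Ioc c (c + δ)) ≤ Real.exp 1 * Real.exp (-L ^ 2 / 2) * δ := by
  have := gaussianReal_real_Ioc_le (a := c) (b := c + δ)
    (M := Real.exp 1 * Real.exp (-L ^ 2 / 2)) (by linarith) fun x hx => by
      refine (gaussianPDFReal_le_exp x).trans ?_
      rw [← Real.exp_add]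
      gcongr
      have h1 : L - δ ≤ x := by linarith [hx.1]
      have h2 : 0 ≤ L - δ := by nlinarith
      nlinarith [mul_self_le_mul_self h2 h1, sq_nonneg δ]
  simpa using this

variable {ι : Type*} [Fintype ι]

lemma memLp_two_eval (P : Measure (ι → ℝ)) [IsGaussian P] (j : ι) :
    MemLp (fun x : ι → ℝ => x j) 2 P :=
  IsGaussian.memLp_dual P (ContinuousLinearMap.proj (R := ℝ) (φ := fun _ : ι => ℝ) j) 2 (by simp)

lemma integrable_eval (P : Measure (ι → ℝ)) [IsGaussian P] (j : ι) :
    Integrable (fun x : ι → ℝ => x j) P := (memLp_two_eval P j).integrable (by norm_num)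

lemma integrable_eval_mul_eval (P : Measure (ι → ℝ)) [IsGaussian P] (j k : ι) :
    Integrable (fun x : ι → ℝ => x j * x k) P :=
  (memLp_two_eval P j).integrable_mul (memLp_two_eval P k)

/-- Each coordinate of a standardised Gaussian vector is independent of the residuals of the
others. -/
lemma indepFun_eval_residual (P : Measure (ι → ℝ)) [IsGaussian P] (h0 : ∀ j, ∫ x, x j ∂P = 0)
    (j : ι) (h1 : ∫ x, x j * x j ∂P = 1) :
    IndepFun (fun x : ι → ℝ => x j)
      (fun x : ι → ℝ => fun k => x k - (∫ y, y k * y j ∂P) * x j) P := by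
  classical
  set ρ : ι → ℝ := fun k => ∫ y, y k * y j ∂P with hρ
  let pr : ι → ((ι → ℝ) →L[ℝ] ℝ) := fun k =>
    ContinuousLinearMap.proj (R := ℝ) (φ := fun _ : ι => ℝ) k
  have hlaw : HasGaussianLaw (fun x : ι → ℝ =>
      ((fun _ : Unit => x j), (fun k => x k - ρ k * x j))) P :=
    (IsGaussian.hasGaussianLaw_id (μ := P)).map_fun
      (ContinuousLinearMap.prod (ContinuousLinearMap.pi fun _ : Unit => pr j)
        (ContinuousLinearMap.pi fun k => pr k - ρ k • pr j))
  have hind := HasGaussianLaw.indepFun_of_covariance_eval (P := P)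
    (X := fun (_ : Unit) (x : ι → ℝ) => x j) (Y := fun k (x : ι → ℝ) => x k - ρ k * x j) hlaw ?_
  · exact hind.comp (φ := fun f : Unit → ℝ => f ()) (ψ := id) (measurable_pi_apply _) measurable_id
  · intro _ k
    have hres : MemLp (fun x : ι → ℝ => x k - ρ k * x j) 2 P :=
      (memLp_two_eval P k).sub ((memLp_two_eval P j).const_mul _)
    rw [covariance_eq_sub (memLp_two_eval P j) hres, h0 j, zero_mul, sub_zero]
    have : ((fun x : ι → ℝ => x j) * fun x : ι → ℝ => x k - ρ k * x j)
        = fun x => x k * x j - ρ k * (x j * x j) := by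
      ext x; simp only [Pi.mul_apply]; ring
    rw [this, integral_sub (integrable_eval_mul_eval P k j)
      ((integrable_eval_mul_eval P j j).const_mul _), integral_const_mul, h1]
    simp [hρ]

lemma integral_eval_mul_eval_le_one (P : Measure (ι → ℝ)) [IsGaussian P] (j k : ι)
    (hj : ∫ x, x j * x j ∂P = 1) (hk : ∫ x, x k * x k ∂P = 1) :
    ∫ x, x k * x j ∂P ≤ 1 := by
  have h : 0 ≤ ∫ x, (x k - x j) * (x k - x j) ∂P := integral_nonneg fun x => mul_self_nonneg _
  have h' : ∀ x : ι → ℝ, (x k - x j) * (x k - x j) = x k * x k + x j * x j - 2 * (x k * x j) :=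
    fun x => by ring
  simp_rw [h'] at h
  rw [integral_sub (by exact (integrable_eval_mul_eval P k k).add (integrable_eval_mul_eval P j j))
      ((integrable_eval_mul_eval P k j).const_mul _),
    integral_add (integrable_eval_mul_eval P k k) (integrable_eval_mul_eval P j j),
    integral_const_mul, hj, hk] at h
  linarith

lemma map_eval_eq_gaussianReal (P : Measure (ι → ℝ)) [IsGaussian P]
    (h0 : ∀ j, ∫ x, x j ∂P = 0) (j : ι) (h1 : ∫ x, x j * x j ∂P = 1) :
    P.map (fun x => x j) = gaussianReal 0 1 := by
  have h := IsGaussian.map_eq_gaussianReal (μ := P)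
    (ContinuousLinearMap.proj (R := ℝ) (φ := fun _ : ι => ℝ) j)
  have hv : Var[fun x : ι → ℝ => x j; P] = 1 := by
    rw [variance_eq_sub (memLp_two_eval P j), h0 j]
    simpa [pow_two] using h1
  have h' : P.map (fun x => x j) =
      gaussianReal (∫ x, x j ∂P) (Var[fun x : ι → ℝ => x j; P]).toNNReal := h
  rw [h', h0 j, hv, Real.toNNReal_one]

/-- The event that `j` maximises `x - c`, ties being broken by the key `e`. -/
def argmaxSet {n : ℕ} (e : ι → Fin n) (c : ι → ℝ) (j : ι) : Set (ι → ℝ) :=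
  {x | ∀ k, x k - c k < x j - c j ∨ (x k - c k = x j - c j ∧ e k ≤ e j)}

lemma measurableSet_argmaxSet {n : ℕ} (e : ι → Fin n) (c : ι → ℝ) (j : ι) :
    MeasurableSet (argmaxSet e c j) := by
  have hm : ∀ k, Measurable fun x : ι → ℝ => x k - c k := fun k => by fun_prop
  rw [argmaxSet, Set.ofPred_forall]
  refine MeasurableSet.iInter fun k => ?_
  exact (measurableSet_lt (hm k) (hm j)).union
    ((measurableSet_eq_fun (hm k) (hm j)).inter (MeasurableSet.const _))

omit [Fintype ι] in
lemma disjoint_argmaxSet {n : ℕ} {e : ι → Fin n} (he : Function.Injective e) (c : ι → ℝ)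
    {i j : ι} (hij : i ≠ j) : Disjoint (argmaxSet e c i) (argmaxSet e c j) := by
  rw [Set.disjoint_left]
  intro x hi hj
  rcases hi j with h | ⟨h, h'⟩ <;> rcases hj i with g | ⟨g, g'⟩
  · linarith
  · linarith
  · linarith
  · exact hij (he (le_antisymm g' h'))

lemma exists_mem_argmaxSet [Nonempty ι] {n : ℕ} (e : ι → Fin n) (c : ι → ℝ) (x : ι → ℝ) :
    ∃ j, x ∈ argmaxSet e c j := by
  obtain ⟨j, hj⟩ := Finite.exists_max fun k => toLex (x k - c k, e k)
  refine ⟨j, fun k => ?_⟩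
  simpa [Prod.Lex.le_iff] using hj k

lemma measureReal_Ioc_inter_argmaxSet_le (P : Measure (ι → ℝ)) [IsGaussian P]
    (h0 : ∀ j, ∫ x, x j ∂P = 0) (h1 : ∀ j, ∫ x, x j * x j ∂P = 1)
    {n : ℕ} (e : ι → Fin n) (c : ι → ℝ) {δ L : ℝ} (hL : 1 ≤ L) (hδ : 0 ≤ δ)
    (hδL : (1 + L) * δ ≤ 1) (j : ι) :
    P.real ({x | x j ∈ Ioc (c j) (c j + δ)} ∩ argmaxSet e c j) ≤
      Real.exp 2 * (1 + L) * δ * P.real (argmaxSet e c j)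
        + Real.exp 1 * Real.exp (-L ^ 2 / 2) * δ := by
  set ρ : ι → ℝ := fun k => ∫ y, y k * y j ∂P with hρ
  have hρ1 : ∀ k, ρ k ≤ 1 := fun k => integral_eval_mul_eval_le_one P j k (h1 j) (h1 k)
  set y := c j + δ with hy
  set V : (ι → ℝ) → ι → ℝ := fun x k => x k - ρ k * x j with hV
  let S : Set (ι → ℝ) :=
    {v | ∀ k, v k < y - c j - (ρ k * y - c k) ∨ (v k = y - c j - (ρ k * y - c k) ∧ e k ≤ e j)}
  have hS : MeasurableSet S := by
    rw [show S = ⋂ k, ({v : ι → ℝ | v k < y - c j - (ρ k * y - c k)} ∪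
      ({v : ι → ℝ | v k = y - c j - (ρ k * y - c k)} ∩ {_v | e k ≤ e j})) by
        ext v; simp [S]]
    refine MeasurableSet.iInter fun k => ?_
    exact (measurableSet_lt (measurable_pi_apply k) measurable_const).union
      ((measurableSet_eq_fun (measurable_pi_apply k) measurable_const).inter
        (MeasurableSet.const _))
  have hind : IndepFun (fun x : ι → ℝ => x j) V P := indepFun_eval_residual P h0 j (h1 j)
  have hmul : ∀ s : Set ℝ, MeasurableSet s →
      P.real ((fun x : ι → ℝ => x j) ⁻¹' s ∩ V ⁻¹' S)
        = (gaussianReal 0 1).real s * P.real (V ⁻¹' S) := fun s hs => by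
    rw [Measure.real, hind.measure_inter_preimage_eq_mul s S hs hS, ENNReal.toReal_mul,
      ← map_eval_eq_gaussianReal P h0 j (h1 j)]
    simp only [Measure.real]
    rw [Measure.map_apply (measurable_pi_apply j) hs]
  have hsub1 : {x : ι → ℝ | x j ∈ Ioc (c j) y} ∩ argmaxSet e c j ⊆
      (fun x : ι → ℝ => x j) ⁻¹' (Ioc (c j) y) ∩ V ⁻¹' S := by
    rintro x ⟨hx, hxA⟩
    refine ⟨hx, fun k => ?_⟩
    have hmon : 0 ≤ (1 - ρ k) * (y - x j) :=
      mul_nonneg (by linarith [hρ1 k]) (by linarith [hx.2])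
    simp only [hV]
    rcases hxA k with h | ⟨h, h'⟩
    · left; nlinarith
    · rcases hmon.eq_or_lt with h'' | h''
      · right; exact ⟨by nlinarith, h'⟩
      · left; nlinarith
  have hsub2 : (fun x : ι → ℝ => x j) ⁻¹' (Ioi y) ∩ V ⁻¹' S ⊆ argmaxSet e c j := by
    rintro x ⟨hx, hxS⟩ k
    have hmon : 0 ≤ (1 - ρ k) * (x j - y) :=
      mul_nonneg (by linarith [hρ1 k]) (by linarith [mem_Ioi.1 (mem_preimage.1 hx)])
    have hk := hxS k
    simp only [hV] at hk
    rcases hk with h | ⟨h, h'⟩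
    · left; nlinarith
    · rcases hmon.eq_or_lt with h'' | h''
      · right; exact ⟨by nlinarith, h'⟩
      · left; nlinarith
  have hup := measureReal_mono (μ := P) hsub1
  have hlow := measureReal_mono (μ := P) hsub2
  rw [hmul _ measurableSet_Ioc] at hup
  rw [hmul _ measurableSet_Ioi] at hlow
  have hs0 : 0 ≤ P.real (V ⁻¹' S) := measureReal_nonneg
  have hs1 : P.real (V ⁻¹' S) ≤ 1 := measureReal_le_one
  refine hup.trans ?_
  have hL0 : 0 ≤ 1 + L := by linarith
  rcases le_or_gt y L with hyL | hyL
  · calc (gaussianReal 0 1).real (Ioc (c j) y) * P.real (V ⁻¹' S)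
        ≤ (Real.exp 2 * (1 + L) * δ * (gaussianReal 0 1).real (Ioi y)) * P.real (V ⁻¹' S) := by
          gcongr; exact gaussianReal_real_Ioc_le_mul_Ioi hL hδ hδL hyL
      _ = Real.exp 2 * (1 + L) * δ * ((gaussianReal 0 1).real (Ioi y) * P.real (V ⁻¹' S)) := by ring
      _ ≤ Real.exp 2 * (1 + L) * δ * P.real (argmaxSet e c j) := by gcongr
      _ ≤ _ := le_add_of_nonneg_right (by positivity)
  · calc (gaussianReal 0 1).real (Ioc (c j) y) * P.real (V ⁻¹' S)
        ≤ (gaussianReal 0 1).real (Ioc (c j) y) * 1 := by gcongr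
      _ ≤ Real.exp 1 * Real.exp (-L ^ 2 / 2) * δ := by
          rw [mul_one]; exact gaussianReal_real_Ioc_le_exp_neg hL hδ hδL hyL
      _ ≤ _ := le_add_of_nonneg_left (by positivity)

/-- Anti-concentration for standardised Gaussian vectors on lower orthants. -/
lemma anticoncentration_of_unit_variance (P : Measure (ι → ℝ)) [IsGaussian P]
    (h0 : ∀ j, ∫ x, x j ∂P = 0) (h1 : ∀ j, ∫ x, x j * x j ∂P = 1)
    (c : ι → ℝ) {δ L : ℝ} (hL : 1 ≤ L) (hδ : 0 ≤ δ)
    (hcard : Fintype.card ι ≤ Real.exp (L ^ 2 / 2)) :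
    P.real {x | (∀ j, x j ≤ c j + δ) ∧ ¬ ∀ j, x j ≤ c j} ≤ 2 * Real.exp 2 * (1 + L) * δ := by
  have he1 : 1 ≤ Real.exp 2 := Real.one_le_exp (by norm_num)
  rcases lt_or_ge 1 ((1 + L) * δ) with hbig | hδL
  · refine measureReal_le_one.trans ?_
    nlinarith
  rcases isEmpty_or_nonempty ι with hι | hι
  · simp only [IsEmpty.forall_iff, not_true_eq_false, and_false, Set.ofPred_false, measureReal_empty]
    positivity
  let e := Fintype.equivFin ι
  have hsub : {x : ι → ℝ | (∀ j, x j ≤ c j + δ) ∧ ¬ ∀ j, x j ≤ c j} ⊆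
      ⋃ j, ({x | x j ∈ Ioc (c j) (c j + δ)} ∩ argmaxSet e c j) := by
    rintro x ⟨hx, hx'⟩
    push Not at hx'
    obtain ⟨k, hk⟩ := hx'
    obtain ⟨j, hj⟩ := exists_mem_argmaxSet e c x
    refine mem_iUnion.2 ⟨j, ⟨?_, hx j⟩, hj⟩
    rcases hj k with h | ⟨h, -⟩ <;> linarith
  have hsum : ∑ j, P.real (argmaxSet e c j) ≤ 1 := by
    rw [← measureReal_iUnion_fintype (fun i j hij => disjoint_argmaxSet e.injective c hij)
      (measurableSet_argmaxSet e c)]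
    exact measureReal_le_one
  have hn : Fintype.card ι * Real.exp (-L ^ 2 / 2) ≤ 1 := by
    calc _ ≤ Real.exp (L ^ 2 / 2) * Real.exp (-L ^ 2 / 2) := by gcongr
      _ = 1 := by rw [← Real.exp_add]; simp [neg_div]
  have he : Real.exp 1 ≤ Real.exp 2 * (1 + L) := by
    have : Real.exp 1 ≤ Real.exp 2 := by gcongr; norm_num
    nlinarith
  have hL0 : 0 ≤ 1 + L := by linarith
  calc P.real _ ≤ P.real (⋃ j, ({x | x j ∈ Ioc (c j) (c j + δ)} ∩ argmaxSet e c j)) :=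
        measureReal_mono hsub
    _ ≤ ∑ j, P.real ({x | x j ∈ Ioc (c j) (c j + δ)} ∩ argmaxSet e c j) :=
        measureReal_iUnion_fintype_le _
    _ ≤ ∑ j, (Real.exp 2 * (1 + L) * δ * P.real (argmaxSet e c j)
          + Real.exp 1 * Real.exp (-L ^ 2 / 2) * δ) :=
        Finset.sum_le_sum fun j _ => measureReal_Ioc_inter_argmaxSet_le P h0 h1 e c hL hδ hδL j
    _ = Real.exp 2 * (1 + L) * δ * ∑ j, P.real (argmaxSet e c j)
          + Real.exp 1 * δ * (Fintype.card ι * Real.exp (-L ^ 2 / 2)) := by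
        rw [Finset.sum_add_distrib, ← Finset.mul_sum]; simp; ring
    _ ≤ Real.exp 2 * (1 + L) * δ * 1 + Real.exp 1 * δ * 1 := by gcongr
    _ ≤ _ := by nlinarith [mul_le_mul_of_nonneg_right he hδ]

/-- Nazarov's inequality: anti-concentration on lower orthants when all variances are at least
`s ^ 2`. -/
lemma anticoncentration (P : Measure (ι → ℝ)) [IsGaussian P]
    (h0 : ∀ j, ∫ x, x j ∂P = 0) {s : ℝ} (hs : 0 < s) (h1 : ∀ j, s ^ 2 ≤ ∫ x, x j * x j ∂P)
    (c : ι → ℝ) {δ L : ℝ} (hL : 1 ≤ L) (hδ : 0 ≤ δ)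
    (hcard : Fintype.card ι ≤ Real.exp (L ^ 2 / 2)) :
    P.real {x | ∀ j, x j ≤ c j + δ} ≤
      P.real {x | ∀ j, x j ≤ c j} + 2 * Real.exp 2 * (1 + L) * (δ / s) := by
  classical
  let σ : ι → ℝ := fun j => √(∫ x, x j * x j ∂P)
  have hvar : ∀ j, 0 < ∫ x, x j * x j ∂P := fun j => lt_of_lt_of_le (by positivity) (h1 j)
  have hσ : ∀ j, 0 < σ j := fun j => Real.sqrt_pos.2 (hvar j)
  have hσs : ∀ j, s ≤ σ j := fun j => Real.le_sqrt_of_sq_le (h1 j)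
  have hσ2 : ∀ j, ∫ x, x j * x j ∂P = σ j ^ 2 := fun j => (Real.sq_sqrt (hvar j).le).symm
  let T : (ι → ℝ) →L[ℝ] (ι → ℝ) := ContinuousLinearMap.pi fun j =>
    (σ j)⁻¹ • ContinuousLinearMap.proj (R := ℝ) (φ := fun _ : ι => ℝ) j
  have hT : ∀ x j, T x j = (σ j)⁻¹ * x j := fun x j => by simp [T]
  have hTm : Measurable T := T.continuous.measurable
  have key := anticoncentration_of_unit_variance (P.map T)
    (fun j => by
      rw [integral_map hTm.aemeasurable (measurable_pi_apply j).aestronglyMeasurable]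
      simp [hT, integral_const_mul, h0])
    (fun j => by
      rw [integral_map hTm.aemeasurable
        (by fun_prop : Measurable fun x : ι → ℝ => x j * x j).aestronglyMeasurable]
      have : ∀ x, T x j * T x j = (σ j)⁻¹ ^ 2 * (x j * x j) := fun x => by rw [hT]; ring
      simp_rw [this]
      rw [integral_const_mul, hσ2]
      field_simp [(hσ j).ne'])
    (fun j => (σ j)⁻¹ * c j) (δ := δ / s) hL (by positivity) hcard
  have hms : MeasurableSet {x : ι → ℝ | (∀ j, x j ≤ (σ j)⁻¹ * c j + δ / s) ∧
      ¬ ∀ j, x j ≤ (σ j)⁻¹ * c j} := by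
    have hm : ∀ d : ι → ℝ, MeasurableSet {x : ι → ℝ | ∀ j, x j ≤ d j} := fun d => by
      rw [Set.ofPred_forall]
      exact MeasurableSet.iInter fun j =>
        measurableSet_le (measurable_pi_apply j) measurable_const
    exact (hm fun j => (σ j)⁻¹ * c j + δ / s).inter (hm fun j => (σ j)⁻¹ * c j).compl
  rw [map_measureReal_apply hTm hms] at key
  have hsub : {x : ι → ℝ | ∀ j, x j ≤ c j + δ} ⊆ {x | ∀ j, x j ≤ c j} ∪
      T ⁻¹' {x : ι → ℝ | (∀ j, x j ≤ (σ j)⁻¹ * c j + δ / s) ∧ ¬ ∀ j, x j ≤ (σ j)⁻¹ * c j} := by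
    intro x hx
    by_cases hxc : ∀ j, x j ≤ c j
    · exact Or.inl hxc
    · refine Or.inr ⟨fun j => ?_, fun h => hxc fun j => ?_⟩
      · rw [hT]
        calc (σ j)⁻¹ * x j ≤ (σ j)⁻¹ * (c j + δ) := by
              have := hσ j
              gcongr; exact hx j
          _ = (σ j)⁻¹ * c j + δ / σ j := by ring
          _ ≤ _ := by gcongr; exact hσs j
      · have := h j
        rw [hT] at this
        exact le_of_mul_le_mul_left this (inv_pos.2 (hσ j))
  calc _ ≤ _ := measureReal_mono hsub
    _ ≤ _ := measureReal_union_le _ _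
    _ ≤ _ := by gcongr

section Interpolation

variable {E : Type*} [NormedAddCommGroup E] [NormedSpace ℝ E] [MeasurableSpace E] [BorelSpace E]
  [CompleteSpace E] [SecondCountableTopology E]

/-- Dilation by `√s`. -/
def sqrtSmul (E : Type*) [NormedAddCommGroup E] [NormedSpace ℝ E] (s : ℝ) : E →L[ℝ] E :=
  √s • ContinuousLinearMap.id ℝ E

omit [MeasurableSpace E] [BorelSpace E] [CompleteSpace E] [SecondCountableTopology E] in
lemma sqrtSmul_apply (s : ℝ) (x : E) : sqrtSmul E s x = √s • x := rfl

lemma charFunDual_map_sqrtSmul (P : Measure E) [IsGaussian P] (h0 : ∫ x, id x ∂P = 0) {s : ℝ}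
    (hs : 0 ≤ s) (L : StrongDual ℝ E) :
    charFunDual (P.map (sqrtSmul E s)) L = Complex.exp (-(s * Var[L; P] : ℝ) / 2) := by
  rw [charFunDual_map, IsGaussian.charFunDual_eq_of_integral_eq_zero h0]
  have : (⇑(L ∘SL sqrtSmul E s) : E → ℝ) = fun x => √s * L x := by
    ext x; simp [sqrtSmul_apply]
  rw [this, variance_const_mul, Real.sq_sqrt hs]

lemma map_sqrtSmul_add (P : Measure E) [IsGaussian P] (h0 : ∫ x, id x ∂P = 0) {s t : ℝ}
    (hs : 0 ≤ s) (ht : 0 ≤ t) :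
    P.map (sqrtSmul E (s + t)) = (P.map (sqrtSmul E s)) ∗ (P.map (sqrtSmul E t)) := by
  refine Measure.ext_of_charFunDual ?_
  ext L
  rw [charFunDual_conv, charFunDual_map_sqrtSmul P h0 (add_nonneg hs ht),
    charFunDual_map_sqrtSmul P h0 hs, charFunDual_map_sqrtSmul P h0 ht, ← Complex.exp_add]
  congr 1
  push_cast
  ring

/-- If replacing a small independent copy of `P` by one of `Q` changes expectations of `m` by at
most `h * B`, up to lower order terms, then the expectations of `m` differ by at most `B`. -/
lemma abs_integral_sub_integral_le_of_local (P Q : Measure E) [IsGaussian P] [IsGaussian Q]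
    (hP : ∫ x, id x ∂P = 0) (hQ : ∫ x, id x ∂Q = 0) {m : E → ℝ} (hm : Continuous m)
    {b : ℝ} (hb : ∀ x, |m x| ≤ b) {B C : ℝ}
    (hloc : ∀ w : E, ∀ h : ℝ, 0 ≤ h →
      |∫ x, m (w + √h • x) ∂P - ∫ x, m (w + √h • x) ∂Q| ≤ h * B + C * (h * √h)) :
    |∫ x, m x ∂P - ∫ x, m x ∂Q| ≤ B := by
  have hintegrable : ∀ ℛ : Measure E, IsProbabilityMeasure ℛ → Integrable m ℛ := fun ℛ _ =>
    Integrable.of_bound hm.aestronglyMeasurable b (Eventually.of_forall hb)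
  have hTm : ∀ s, Measurable (sqrtSmul E s) := fun s => (sqrtSmul E s).continuous.measurable
  let u : ℝ → ℝ := fun s => ∫ x, m x ∂((P.map (sqrtSmul E s)) ∗ (Q.map (sqrtSmul E (1 - s))))
  have hstep : ∀ s h : ℝ, 0 ≤ s → 0 ≤ h → s + h ≤ 1 →
      |u (s + h) - u s| ≤ h * B + C * (h * √h) := by
    intro s h hs hh hsh
    let ℛ := (P.map (sqrtSmul E s)) ∗ (Q.map (sqrtSmul E (1 - s - h)))
    have e1 : u (s + h) = ∫ w, (∫ x, m (w + √h • x) ∂P) ∂ℛ := by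
      have : (P.map (sqrtSmul E (s + h))) ∗ (Q.map (sqrtSmul E (1 - (s + h))))
          = ℛ ∗ (P.map (sqrtSmul E h)) := by
        rw [map_sqrtSmul_add P hP hs hh, Measure.conv_assoc,
          Measure.conv_comm (P.map (sqrtSmul E h)), ← Measure.conv_assoc, ← sub_sub]
      simp only [u]
      rw [this, integral_conv (hintegrable _ inferInstance)]
      congr 1 with w
      rw [integral_map (hTm h).aemeasurable
        (by fun_prop : Continuous fun y => m (w + y)).aestronglyMeasurable]
      rfl
    have e2 : u s = ∫ w, (∫ x, m (w + √h • x) ∂Q) ∂ℛ := by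
      have : (P.map (sqrtSmul E s)) ∗ (Q.map (sqrtSmul E (1 - s)))
          = ℛ ∗ (Q.map (sqrtSmul E h)) := by
        rw [show 1 - s = (1 - s - h) + h by ring, map_sqrtSmul_add Q hQ (by linarith) hh,
          ← Measure.conv_assoc]
      simp only [u]
      rw [this, integral_conv (hintegrable _ inferInstance)]
      congr 1 with w
      rw [integral_map (hTm h).aemeasurable
        (by fun_prop : Continuous fun y => m (w + y)).aestronglyMeasurable]
      rfl
    have hI : ∀ N : Measure E, IsProbabilityMeasure N →
        Integrable (fun w => ∫ x, m (w + √h • x) ∂N) ℛ := by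
      intro N _
      refine Integrable.of_bound (C := b) ?_ (Eventually.of_forall fun w => ?_)
      · exact (StronglyMeasurable.integral_prod_right'
          (f := fun p : E × E => m (p.1 + √h • p.2))
          (by fun_prop : Continuous fun p : E × E => m (p.1 + √h • p.2)).stronglyMeasurable
          ).aestronglyMeasurable
      · refine (norm_integral_le_of_norm_le_const (C := b)
          (Eventually.of_forall fun x => hb _)).trans ?_
        simp
    rw [e1, e2, ← integral_sub (hI P inferInstance) (hI Q inferInstance), ← Real.norm_eq_abs]
    refine (norm_integral_le_of_norm_le_const (C := h * B + C * (h * √h))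
      (Eventually.of_forall fun w => by rw [Real.norm_eq_abs]; exact hloc w h hh)).trans ?_
    simp
  have hu1 : u 1 = ∫ x, m x ∂P := by
    have h1 : P.map (sqrtSmul E 1) = P := by
      rw [show (sqrtSmul E 1 : E → E) = id by ext x; simp [sqrtSmul_apply], Measure.map_id]
    have h2 : Q.map (sqrtSmul E (1 - 1)) = Measure.dirac 0 := by
      rw [show (sqrtSmul E (1 - 1) : E → E) = fun _ => 0 by ext x; simp [sqrtSmul_apply]]
      simp
    simp only [u]
    rw [h1, h2, Measure.conv_dirac_zero]
  have hu0 : u 0 = ∫ x, m x ∂Q := by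
    have h1 : Q.map (sqrtSmul E (1 - 0)) = Q := by
      rw [show (sqrtSmul E (1 - 0) : E → E) = id by ext x; simp [sqrtSmul_apply], Measure.map_id]
    have h2 : P.map (sqrtSmul E 0) = Measure.dirac 0 := by
      rw [show (sqrtSmul E 0 : E → E) = fun _ => 0 by ext x; simp [sqrtSmul_apply]]
      simp
    simp only [u]
    rw [h1, h2, Measure.dirac_zero_conv]
  have hn : ∀ n : ℕ, |∫ x, m x ∂P - ∫ x, m x ∂Q| ≤ B + C * √(1 / ((n : ℝ) + 1)) := by
    intro n
    set h : ℝ := 1 / ((n : ℝ) + 1) with hh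
    have hh0 : 0 ≤ h := by positivity
    have hnh : ((n : ℝ) + 1) * h = 1 := by rw [hh]; field_simp
    have hind : ∀ k : ℕ, k ≤ n + 1 → |u (k * h) - u 0| ≤ k * (h * B + C * (h * √h)) := by
      intro k
      induction k with
      | zero => intro _; simp
      | succ k ih =>
        intro hk
        have hk' : (k : ℝ) + 1 ≤ n + 1 := by exact_mod_cast hk
        have := hstep (k * h) h (by positivity) hh0 (by nlinarith)
        have h3 := ih (by omega)
        have h4 : ((k + 1 : ℕ) : ℝ) * h = k * h + h := by push_cast; ring
        rw [h4]
        calc |u (k * h + h) - u 0| ≤ |u (k * h + h) - u (k * h)| + |u (k * h) - u 0| :=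
              abs_sub_le _ _ _
          _ ≤ _ := by push_cast; linarith
    have := hind (n + 1) le_rfl
    push_cast at this
    rw [hnh, hu1, hu0] at this
    calc _ ≤ _ := this
      _ = (((n : ℝ) + 1) * h) * (B + C * √h) := by ring
      _ = _ := by rw [hnh, one_mul]
  have hlim : Tendsto (fun n : ℕ => B + C * √(1 / ((n : ℝ) + 1))) atTop (𝓝 (B + C * √0)) :=
    tendsto_const_nhds.add (tendsto_const_nhds.mul
      ((Real.continuous_sqrt.tendsto 0).comp tendsto_one_div_add_atTop_nhds_zero_nat))
  simpa using ge_of_tendsto' hlim hn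

end Interpolation

lemma integral_id_eq_zero (P : Measure (ι → ℝ)) [IsGaussian P] (h0 : ∀ j, ∫ x, x j ∂P = 0) :
    ∫ x, id x ∂P = 0 := by
  ext j
  rw [eval_integral (fun i => by simpa using integrable_eval P i)]
  simpa using h0 j

lemma integrable_norm_pow_three (P : Measure (ι → ℝ)) [IsGaussian P] :
    Integrable (fun x : ι → ℝ => ‖x‖ ^ 3) P := by
  have := (IsGaussian.memLp_id P 3 (by simp)).integrable_norm_pow (by norm_num)
  simpa using this

/-- Integrating a second order expansion against a centred Gaussian measure. -/
lemma abs_integral_sub_quadratic_le (P : Measure (ι → ℝ)) [IsGaussian P]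
    (h0 : ∀ j, ∫ x, x j ∂P = 0) {m : (ι → ℝ) → ℝ} (hm : Continuous m) {b : ℝ}
    (hb : ∀ x, |m x| ≤ b) {w : ι → ℝ} {D : ι → ℝ} {H : ι → ι → ℝ} {C : ℝ}
    (htaylor : ∀ x : ι → ℝ, |m (w + x) - m w - ∑ j, D j * x j
      - (∑ j, ∑ k, H j k * (x j * x k)) / 2| ≤ C * ‖x‖ ^ 3) {r : ℝ} (hr : 0 ≤ r) :
    |∫ x, m (w + r • x) ∂P - (m w + r ^ 2 / 2 * ∑ j, ∑ k, H j k * ∫ x, x j * x k ∂P)|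
      ≤ C * (r ^ 2 * r) * ∫ x, ‖x‖ ^ 3 ∂P := by
  have i1 : Integrable (fun x => m (w + r • x)) P :=
    Integrable.of_bound (by fun_prop : Continuous fun x => m (w + r • x)).aestronglyMeasurable b
      (Eventually.of_forall fun x => hb _)
  have i2 : Integrable (fun x : ι → ℝ => r * ∑ j, D j * x j) P :=
    (integrable_finsetSum _ fun j _ => (integrable_eval P j).const_mul _).const_mul _
  have i3 : Integrable (fun x : ι → ℝ => r ^ 2 / 2 * ∑ j, ∑ k, H j k * (x j * x k)) P :=
    (integrable_finsetSum _ fun j _ => integrable_finsetSum _ fun k _ =>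
      (integrable_eval_mul_eval P j k).const_mul _).const_mul _
  have e2 : ∫ x, r * ∑ j, D j * x j ∂P = 0 := by
    rw [integral_const_mul, integral_finsetSum _ fun j _ => (integrable_eval P j).const_mul _]
    simp [integral_const_mul, h0]
  have e3 : ∫ x, r ^ 2 / 2 * ∑ j, ∑ k, H j k * (x j * x k) ∂P
      = r ^ 2 / 2 * ∑ j, ∑ k, H j k * ∫ x, x j * x k ∂P := by
    rw [integral_const_mul, integral_finsetSum _ fun j _ => integrable_finsetSum _ fun k _ =>
      (integrable_eval_mul_eval P j k).const_mul _]
    congr 1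
    refine Finset.sum_congr rfl fun j _ => ?_
    rw [integral_finsetSum _ fun k _ => (integrable_eval_mul_eval P j k).const_mul _]
    simp [integral_const_mul]
  have j1 : Integrable (fun x => m (w + r • x) - m w) P := i1.sub (integrable_const _)
  have j2 : Integrable (fun x => m (w + r • x) - m w - r * ∑ j, D j * x j) P := j1.sub i2
  have e : ∫ x, m (w + r • x) ∂P - (m w + r ^ 2 / 2 * ∑ j, ∑ k, H j k * ∫ x, x j * x k ∂P)
      = ∫ x, (m (w + r • x) - m w - r * (∑ j, D j * x j)
          - r ^ 2 / 2 * ∑ j, ∑ k, H j k * (x j * x k)) ∂P := by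
    rw [integral_sub j2 i3, integral_sub j1 i2, integral_sub i1 (integrable_const _), e2, e3]
    simp
    ring
  rw [e, ← integral_const_mul, ← Real.norm_eq_abs]
  refine norm_integral_le_of_norm_le ((integrable_norm_pow_three P).const_mul _)
    (Eventually.of_forall fun x => ?_)
  have := htaylor (r • x)
  simp only [Pi.smul_apply, smul_eq_mul, norm_smul, Real.norm_eq_abs, abs_of_nonneg hr] at this
  rw [Real.norm_eq_abs]
  calc _ = |m (w + r • x) - m w - ∑ j, D j * (r * x j)
      - (∑ j, ∑ k, H j k * (r * x j * (r * x k))) / 2| := by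
        congr 2
        · rw [Finset.mul_sum]
          congr 1
          exact Finset.sum_congr rfl fun j _ => by ring
        · rw [Finset.mul_sum, Finset.sum_div]
          refine Finset.sum_congr rfl fun j _ => ?_
          rw [Finset.mul_sum, Finset.sum_div]
          exact Finset.sum_congr rfl fun k _ => by ring
    _ ≤ _ := this
    _ = _ := by ring

/-- Comparison of smooth functionals of two centred Gaussian vectors. -/
lemma abs_integral_sub_integral_le (P Q : Measure (ι → ℝ)) [IsGaussian P] [IsGaussian Q]
    (hP : ∀ j, ∫ x, x j ∂P = 0) (hQ : ∀ j, ∫ x, x j ∂Q = 0) {Δ : ℝ}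
    (hΔ : ∀ j k, |∫ x, x j * x k ∂P - ∫ x, x j * x k ∂Q| ≤ Δ)
    {m : (ι → ℝ) → ℝ} (hm : Continuous m) {b : ℝ} (hb : ∀ x, |m x| ≤ b)
    {D : (ι → ℝ) → ι → ℝ} {H : (ι → ℝ) → ι → ι → ℝ} {C M : ℝ}
    (hM : ∀ w, ∑ j, ∑ k, |H w j k| ≤ M)
    (htaylor : ∀ w x : ι → ℝ, |m (w + x) - m w - ∑ j, D w j * x j
      - (∑ j, ∑ k, H w j k * (x j * x k)) / 2| ≤ C * ‖x‖ ^ 3) (hΔ0 : 0 ≤ Δ) :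
    |∫ x, m x ∂P - ∫ x, m x ∂Q| ≤ M * Δ / 2 := by
  refine abs_integral_sub_integral_le_of_local P Q (integral_id_eq_zero P hP)
    (integral_id_eq_zero Q hQ) hm hb (C := C * (∫ x, ‖x‖ ^ 3 ∂P + ∫ x, ‖x‖ ^ 3 ∂Q))
    fun w h hh => ?_
  have h1 := abs_integral_sub_quadratic_le P hP hm hb (htaylor w) (Real.sqrt_nonneg h)
  have h2 := abs_integral_sub_quadratic_le Q hQ hm hb (htaylor w) (Real.sqrt_nonneg h)
  rw [Real.sq_sqrt hh] at h1 h2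
  have h3 : |∑ j, ∑ k, H w j k * ∫ x, x j * x k ∂P - ∑ j, ∑ k, H w j k * ∫ x, x j * x k ∂Q|
      ≤ M * Δ := by
    simp_rw [← Finset.sum_sub_distrib, ← mul_sub]
    calc _ ≤ ∑ j, |∑ k, H w j k * (∫ x, x j * x k ∂P - ∫ x, x j * x k ∂Q)| :=
          Finset.abs_sum_le_sum_abs _ _
      _ ≤ ∑ j, ∑ k, |H w j k * (∫ x, x j * x k ∂P - ∫ x, x j * x k ∂Q)| :=
          Finset.sum_le_sum fun j _ => Finset.abs_sum_le_sum_abs _ _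
      _ ≤ ∑ j, ∑ k, |H w j k| * Δ := by
          refine Finset.sum_le_sum fun j _ => Finset.sum_le_sum fun k _ => ?_
          rw [abs_mul]
          exact mul_le_mul_of_nonneg_left (hΔ j k) (abs_nonneg _)
      _ = (∑ j, ∑ k, |H w j k|) * Δ := by simp_rw [Finset.sum_mul]
      _ ≤ _ := mul_le_mul_of_nonneg_right (hM w) hΔ0
  rw [abs_le] at h1 h2 h3 ⊢
  have h4 := mul_le_mul_of_nonneg_left h3.1 (by positivity : 0 ≤ h / 2)
  have h5 := mul_le_mul_of_nonneg_left h3.2 (by positivity : 0 ≤ h / 2)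
  constructor <;> nlinarith [h1.1, h1.2, h2.1, h2.2]

/-- The partition function of the soft maximum of `w - c` at inverse temperature `β`. -/
def partitionFun (β : ℝ) (c w : ι → ℝ) : ℝ := ∑ j, Real.exp (β * (w j - c j))

/-- The soft maximum of `w - c`. -/
def softMax (β : ℝ) (c w : ι → ℝ) : ℝ := β⁻¹ * Real.log (partitionFun β c w)

/-- The Gibbs weights of the soft maximum of `w - c`. -/
def gibbs (β : ℝ) (c w : ι → ℝ) (j : ι) : ℝ := Real.exp (β * (w j - c j)) / partitionFun β c w

/-- The mean of `y` under the Gibbs weights. -/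
def gibbsMean (β : ℝ) (c w y : ι → ℝ) : ℝ := ∑ j, gibbs β c w j * y j

section SoftMax

variable [Nonempty ι] (β : ℝ) (c : ι → ℝ)

lemma partitionFun_pos (w : ι → ℝ) : 0 < partitionFun β c w :=
  Finset.sum_pos (fun _ _ => Real.exp_pos _) Finset.univ_nonempty

lemma gibbs_nonneg (w : ι → ℝ) (j : ι) : 0 ≤ gibbs β c w j :=
  div_nonneg (Real.exp_pos _).le (partitionFun_pos β c w).le

lemma sum_gibbs (w : ι → ℝ) : ∑ j, gibbs β c w j = 1 := by
  simp only [gibbs]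
  rw [← Finset.sum_div]
  exact div_self (partitionFun_pos β c w).ne'

lemma abs_gibbsMean_le (w : ι → ℝ) {y : ι → ℝ} {M : ℝ} (hy : ∀ j, |y j| ≤ M) :
    |gibbsMean β c w y| ≤ M := by
  calc |gibbsMean β c w y| ≤ ∑ j, |gibbs β c w j * y j| := Finset.abs_sum_le_sum_abs _ _
    _ ≤ ∑ j, gibbs β c w j * M := by
        refine Finset.sum_le_sum fun j _ => ?_
        rw [abs_mul, abs_of_nonneg (gibbs_nonneg β c w j)]
        exact mul_le_mul_of_nonneg_left (hy j) (gibbs_nonneg β c w j)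
    _ = M := by rw [← Finset.sum_mul, sum_gibbs, one_mul]

omit [Nonempty ι] in
lemma continuous_partitionFun : Continuous (partitionFun β c) := by
  unfold partitionFun
  fun_prop

lemma continuous_softMax : Continuous (softMax β c) := by
  unfold softMax
  exact continuous_const.mul
    ((continuous_partitionFun β c).log fun w => (partitionFun_pos β c w).ne')

omit [Fintype ι] [Nonempty ι] in
lemma hasDerivAt_exp_line (w x : ι → ℝ) (j : ι) (r : ℝ) :
    HasDerivAt (fun r : ℝ => Real.exp (β * ((w + r • x) j - c j)))
      (Real.exp (β * ((w + r • x) j - c j)) * (β * x j)) r := by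
  have h : HasDerivAt (fun r : ℝ => β * ((w + r • x) j - c j)) (β * x j) r := by
    have := ((((hasDerivAt_id r).mul_const (x j)).const_add (w j)).sub_const (c j)).const_mul β
    simpa using this
  exact h.exp

lemma hasDerivAt_partitionFun_line (w x : ι → ℝ) (r : ℝ) :
    HasDerivAt (fun r : ℝ => partitionFun β c (w + r • x))
      (β * (partitionFun β c (w + r • x) * gibbsMean β c (w + r • x) x)) r := by
  have h : HasDerivAt (fun r : ℝ => partitionFun β c (w + r • x))
      (∑ j, Real.exp (β * ((w + r • x) j - c j)) * (β * x j)) r :=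
    HasDerivAt.fun_sum fun j _ => hasDerivAt_exp_line β c w x j r
  convert h using 1
  simp only [gibbsMean, gibbs]
  rw [Finset.mul_sum, Finset.mul_sum]
  refine Finset.sum_congr rfl fun j _ => ?_
  have := (partitionFun_pos β c (w + r • x)).ne'
  field_simp

lemma hasDerivAt_softMax_line {β : ℝ} (hβ : 0 < β) (w x : ι → ℝ) (r : ℝ) :
    HasDerivAt (fun r : ℝ => softMax β c (w + r • x)) (gibbsMean β c (w + r • x) x) r := by
  have hS := (partitionFun_pos β c (w + r • x)).ne'
  refine (((hasDerivAt_partitionFun_line β c w x r).log hS).const_mul β⁻¹).congr_deriv ?_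
  have := hβ.ne'
  field_simp

lemma hasDerivAt_gibbsMean_line (w x y : ι → ℝ) (r : ℝ) :
    HasDerivAt (fun r : ℝ => gibbsMean β c (w + r • x) y)
      (β * (gibbsMean β c (w + r • x) (fun j => y j * x j)
        - gibbsMean β c (w + r • x) y * gibbsMean β c (w + r • x) x)) r := by
  have hS := (partitionFun_pos β c (w + r • x)).ne'
  have h : HasDerivAt (fun r : ℝ => gibbsMean β c (w + r • x) y)
      (∑ j, ((Real.exp (β * ((w + r • x) j - c j)) * (β * x j)) * partitionFun β c (w + r • x)
        - Real.exp (β * ((w + r • x) j - c j)) *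
          (β * (partitionFun β c (w + r • x) * gibbsMean β c (w + r • x) x)))
        / partitionFun β c (w + r • x) ^ 2 * y j) r :=
    HasDerivAt.fun_sum fun j _ => ((hasDerivAt_exp_line β c w x j r).div
      (hasDerivAt_partitionFun_line β c w x r) hS).mul_const (y j)
  convert h using 1
  set a := gibbsMean β c (w + r • x) x
  simp only [gibbsMean, gibbs]
  rw [Finset.sum_mul, ← Finset.sum_sub_distrib, Finset.mul_sum]
  refine Finset.sum_congr rfl fun j _ => ?_
  field_simp

lemma le_softMax {β : ℝ} (hβ : 0 < β) (w : ι → ℝ) (j : ι) : w j - c j ≤ softMax β c w := by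
  have h : β * (w j - c j) ≤ Real.log (partitionFun β c w) := by
    rw [Real.le_log_iff_exp_le (partitionFun_pos β c w)]
    exact Finset.single_le_sum (f := fun j => Real.exp (β * (w j - c j)))
      (fun _ _ => (Real.exp_pos _).le) (Finset.mem_univ j)
  rw [softMax, inv_mul_eq_div, le_div_iff₀ hβ, mul_comm]
  exact h

lemma softMax_le {β : ℝ} (hβ : 0 < β) {w : ι → ℝ} {t : ℝ} (h : ∀ j, w j - c j ≤ t) :
    softMax β c w ≤ t + Real.log (Fintype.card ι) / β := by
  have hn : (0 : ℝ) < Fintype.card ι := by exact_mod_cast Fintype.card_pos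
  have hle : partitionFun β c w ≤ Fintype.card ι * Real.exp (β * t) := by
    calc partitionFun β c w ≤ ∑ _j : ι, Real.exp (β * t) := by
          refine Finset.sum_le_sum fun j _ => Real.exp_le_exp.2 ?_
          exact mul_le_mul_of_nonneg_left (h j) hβ.le
      _ = _ := by simp
  have := Real.log_le_log (partitionFun_pos β c w) hle
  rw [Real.log_mul hn.ne' (Real.exp_pos _).ne', Real.log_exp] at this
  rw [softMax, inv_mul_eq_div, div_le_iff₀ hβ]
  field_simp
  linarith

end SoftMax

lemma abs_sub_quadratic_le_of_deriv_bound {f f₁ f₂ f₃ : ℝ → ℝ} {K : ℝ}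
    (h1 : ∀ t, HasDerivAt f (f₁ t) t) (h2 : ∀ t, HasDerivAt f₁ (f₂ t) t)
    (h3 : ∀ t, HasDerivAt f₂ (f₃ t) t) (hK : ∀ t, |f₃ t| ≤ K) :
    |f 1 - f 0 - f₁ 0 - f₂ 0 / 2| ≤ K := by
  have hK0 : 0 ≤ K := (abs_nonneg _).trans (hK 0)
  have mvt : ∀ {g g' : ℝ → ℝ}, (∀ t, HasDerivAt g (g' t) t) → (∀ t ∈ Icc (0 : ℝ) 1, |g' t| ≤ K) →
      ∀ t ∈ Icc (0 : ℝ) 1, |g t - g 0| ≤ K := by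
    intro g g' hg hb t ht
    have h := (convex_Icc (0 : ℝ) 1).norm_image_sub_le_of_norm_hasDerivWithin_le
      (fun t _ => (hg t).hasDerivWithinAt) hb (left_mem_Icc.2 zero_le_one) ht
    simp only [Real.norm_eq_abs, sub_zero] at h
    refine h.trans (mul_le_of_le_one_right hK0 ?_)
    rw [abs_of_nonneg ht.1]
    exact ht.2
  have s2 := mvt h3 fun t _ => hK t
  have s1 := mvt (g := fun t => f₁ t - f₂ 0 * t) (g' := fun t => f₂ t - f₂ 0)
    (fun t => ((h2 t).sub ((hasDerivAt_id t).const_mul (f₂ 0))).congr_deriv (by simp)) s2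
  have s0 := mvt (g := fun t => f t - f₁ 0 * t - f₂ 0 * (t ^ 2 / 2))
    (g' := fun t => (f₁ t - f₂ 0 * t) - (f₁ 0 - f₂ 0 * 0))
    (fun t => by
      refine (((h1 t).sub ((hasDerivAt_id t).const_mul (f₁ 0))).sub
        ((((hasDerivAt_id t).pow 2).div_const 2).const_mul (f₂ 0))).congr_deriv ?_
      simp
      ring) s1 1 (right_mem_Icc.2 zero_le_one)
  convert s0 using 2
  simp
  ring

section SmoothIndicator

variable [Nonempty ι] (c : ι → ℝ)

/-- The Hessian of `g ∘ softMax`, in terms of the values `a = g'` and `b = g''`. -/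
def softHessian [DecidableEq ι] (β : ℝ) (c : ι → ℝ) (a b : ℝ) (w : ι → ℝ) (j k : ι) : ℝ :=
  (b - β * a) * (gibbs β c w j * gibbs β c w k) + if j = k then β * a * gibbs β c w j else 0

lemma sum_abs_softHessian_le [DecidableEq ι] {β : ℝ} (hβ : 0 < β) (a b : ℝ) (w : ι → ℝ) :
    ∑ j, ∑ k, |softHessian β c a b w j k| ≤ |b| + 2 * β * |a| := by
  have hg := gibbs_nonneg β c w
  calc ∑ j, ∑ k, |softHessian β c a b w j k|
      ≤ ∑ j, ∑ k, (|b - β * a| * (gibbs β c w j * gibbs β c w k)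
          + if j = k then β * |a| * gibbs β c w j else 0) := by
        refine Finset.sum_le_sum fun j _ => Finset.sum_le_sum fun k _ => ?_
        refine (abs_add_le _ _).trans (add_le_add ?_ ?_)
        · rw [abs_mul, abs_of_nonneg (mul_nonneg (hg j) (hg k))]
        · split_ifs
          · rw [abs_mul, abs_mul, abs_of_pos hβ, abs_of_nonneg (hg j)]
          · simp
    _ = |b - β * a| + β * |a| := by
        simp only [Finset.sum_add_distrib, Finset.sum_ite_eq, Finset.mem_univ, if_true,
          ← Finset.mul_sum, sum_gibbs, mul_one]
    _ ≤ (|b| + |β * a|) + β * |a| := by gcongr; exact abs_sub _ _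
    _ = _ := by rw [abs_mul, abs_of_pos hβ]; ring

omit [Nonempty ι] in
lemma sum_softHessian_mul [DecidableEq ι] (β a b : ℝ) (w x : ι → ℝ) :
    ∑ j, ∑ k, softHessian β c a b w j k * (x j * x k)
      = b * gibbsMean β c w x ^ 2
        + a * (β * (gibbsMean β c w (fun j => x j * x j)
          - gibbsMean β c w x * gibbsMean β c w x)) := by
  have h1 : ∑ j, ∑ k, (b - β * a) * (gibbs β c w j * gibbs β c w k) * (x j * x k)
      = (b - β * a) * (gibbsMean β c w x * gibbsMean β c w x) := by
    simp only [gibbsMean]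
    rw [Finset.sum_mul_sum, Finset.mul_sum]
    refine Finset.sum_congr rfl fun j _ => ?_
    rw [Finset.mul_sum]
    exact Finset.sum_congr rfl fun k _ => by ring
  have h2 : ∑ j, ∑ k, (if j = k then β * a * gibbs β c w j else 0) * (x j * x k)
      = β * a * gibbsMean β c w (fun j => x j * x j) := by
    simp only [gibbsMean, ite_mul, zero_mul, Finset.sum_ite_eq, Finset.mem_univ, if_true]
    rw [Finset.mul_sum]
    exact Finset.sum_congr rfl fun k _ => by ring
  simp only [softHessian, add_mul, Finset.sum_add_distrib]
  rw [h1, h2]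
  ring

/-- Second order expansion of a smooth function of the soft maximum. -/
lemma softMax_taylor [DecidableEq ι] {β : ℝ} (hβ : 0 < β) {g g₁ g₂ g₃ : ℝ → ℝ} {G : ℝ}
    (h1 : ∀ t, HasDerivAt g (g₁ t) t) (h2 : ∀ t, HasDerivAt g₁ (g₂ t) t)
    (h3 : ∀ t, HasDerivAt g₂ (g₃ t) t)
    (hG1 : ∀ t, |g₁ t| ≤ G) (hG2 : ∀ t, |g₂ t| ≤ G) (hG3 : ∀ t, |g₃ t| ≤ G) (w x : ι → ℝ) :
    |g (softMax β c (w + x)) - g (softMax β c w) - ∑ j, g₁ (softMax β c w) * gibbs β c w j * x j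
      - (∑ j, ∑ k, softHessian β c (g₁ (softMax β c w)) (g₂ (softMax β c w)) w j k
        * (x j * x k)) / 2| ≤ G * (1 + 6 * β + 6 * β ^ 2) * ‖x‖ ^ 3 := by
  set F : ℝ → ℝ := fun r => softMax β c (w + r • x) with hF
  set p : ℝ → ℝ := fun r => gibbsMean β c (w + r • x) x with hp
  set q : ℝ → ℝ := fun r => gibbsMean β c (w + r • x) (fun j => x j * x j) with hq
  set e : ℝ → ℝ := fun r => gibbsMean β c (w + r • x) (fun j => x j * x j * x j) with he
  have dF : ∀ r, HasDerivAt F (p r) r := hasDerivAt_softMax_line c hβ w x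
  have dp : ∀ r, HasDerivAt p (β * (q r - p r * p r)) r := hasDerivAt_gibbsMean_line β c w x x
  have dq : ∀ r, HasDerivAt q (β * (e r - q r * p r)) r :=
    hasDerivAt_gibbsMean_line β c w x fun j => x j * x j
  set M := ‖x‖ with hM
  have hM0 : 0 ≤ M := norm_nonneg x
  have hx : ∀ j, |x j| ≤ M := fun j => norm_le_pi_norm x j
  have bp : ∀ r, |p r| ≤ M := fun r => abs_gibbsMean_le β c _ hx
  have bq : ∀ r, |q r| ≤ M * M := fun r => abs_gibbsMean_le β c _ fun j => by
    rw [abs_mul]; exact mul_le_mul (hx j) (hx j) (abs_nonneg _) hM0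
  have be : ∀ r, |e r| ≤ M * M * M := fun r => abs_gibbsMean_le β c _ fun j => by
    rw [abs_mul, abs_mul]
    exact mul_le_mul (mul_le_mul (hx j) (hx j) (abs_nonneg _) hM0) (hx j) (abs_nonneg _)
      (by positivity)
  have bv : ∀ r, |q r - p r * p r| ≤ 2 * (M * M) := fun r => by
    refine (abs_sub _ _).trans ?_
    rw [abs_mul]
    linarith [bq r, mul_le_mul (bp r) (bp r) (abs_nonneg _) hM0]
  have bpv : ∀ r, |p r * (q r - p r * p r)| ≤ M * (2 * (M * M)) := fun r => by
    rw [abs_mul]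
    exact mul_le_mul (bp r) (bv r) (abs_nonneg _) hM0
  have bk : ∀ r, |(e r - q r * p r) - 2 * (p r * (q r - p r * p r))| ≤ 6 * (M * M * M) :=
      fun r => by
    have h4 : |q r * p r| ≤ M * M * M := by
      rw [abs_mul]
      exact mul_le_mul (bq r) (bp r) (abs_nonneg _) (by positivity)
    refine (abs_sub _ _).trans ?_
    rw [abs_mul, abs_of_pos (by norm_num : (0 : ℝ) < 2)]
    linarith [abs_sub (e r) (q r * p r), be r, bpv r]
  have key := abs_sub_quadratic_le_of_deriv_bound
    (f := fun r => g (F r)) (f₁ := fun r => g₁ (F r) * p r)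
    (f₂ := fun r => g₂ (F r) * p r ^ 2 + g₁ (F r) * (β * (q r - p r * p r)))
    (f₃ := fun r => g₃ (F r) * (p r * p r * p r) + 3 * β * (g₂ (F r) * (p r * (q r - p r * p r)))
      + β ^ 2 * (g₁ (F r) * ((e r - q r * p r) - 2 * (p r * (q r - p r * p r)))))
    (K := G * (1 + 6 * β + 6 * β ^ 2) * M ^ 3)
    (fun r => (h1 (F r)).comp r (dF r))
    (fun r => by
      refine (((h2 (F r)).comp r (dF r)).mul (dp r)).congr_deriv ?_
      simp only [Function.comp_apply]
      ring)
    (fun r => by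
      refine ((((h3 (F r)).comp r (dF r)).mul ((dp r).pow 2)).add
        (((h2 (F r)).comp r (dF r)).mul
          (((dq r).sub ((dp r).mul (dp r))).const_mul β))).congr_deriv ?_
      simp [Pi.mul_apply, Pi.sub_apply, Pi.pow_apply]
      ring)
    (fun r => by
      have hG0 : 0 ≤ G := (abs_nonneg _).trans (hG1 0)
      have t1 : |g₃ (F r) * (p r * p r * p r)| ≤ G * (M * M * M) := by
        rw [abs_mul, abs_mul, abs_mul]
        have := bp r
        gcongr
        exact hG3 _
      have t2 : |g₂ (F r) * (p r * (q r - p r * p r))| ≤ G * (M * (2 * (M * M))) := by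
        rw [abs_mul]
        exact mul_le_mul (hG2 _) (bpv r) (abs_nonneg _) hG0
      have t3 : |g₁ (F r) * ((e r - q r * p r) - 2 * (p r * (q r - p r * p r)))|
          ≤ G * (6 * (M * M * M)) := by
        rw [abs_mul]
        exact mul_le_mul (hG1 _) (bk r) (abs_nonneg _) hG0
      refine (abs_add_le _ _).trans ?_
      have t4 := abs_add_le (g₃ (F r) * (p r * p r * p r))
        (3 * β * (g₂ (F r) * (p r * (q r - p r * p r))))
      rw [abs_mul (3 * β), abs_of_pos (by positivity : 0 < 3 * β)] at t4
      rw [abs_mul (β ^ 2), abs_of_pos (by positivity : 0 < β ^ 2)]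
      have t5 := mul_le_mul_of_nonneg_left t2 (by positivity : 0 ≤ 3 * β)
      have t6 := mul_le_mul_of_nonneg_left t3 (by positivity : 0 ≤ β ^ 2)
      calc _ ≤ _ := add_le_add t4 le_rfl
        _ ≤ G * (M * M * M) + 3 * β * (G * (M * (2 * (M * M)))) + β ^ 2 * (G * (6 * (M * M * M))) :=
          add_le_add (add_le_add t1 t5) t6
        _ = _ := by ring)
  convert key using 2
  simp only [hF, hp, hq, one_smul, zero_smul, add_zero]
  rw [sum_softHessian_mul]
  congr 2
  simp only [gibbsMean]
  rw [Finset.mul_sum]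
  exact Finset.sum_congr rfl fun j _ => by ring

end SmoothIndicator

lemma exists_abs_le_of_continuous_of_zero {f : ℝ → ℝ} (hf : Continuous f)
    (h0 : ∀ t, t ∉ Icc (0 : ℝ) 1 → f t = 0) : ∃ G, ∀ t, |f t| ≤ G := by
  obtain ⟨G, hG⟩ := isCompact_Icc.exists_bound_of_continuousOn hf.continuousOn
  refine ⟨max G 0, fun t => ?_⟩
  by_cases ht : t ∈ Icc (0 : ℝ) 1
  · exact (hG t ht).trans (le_max_left _ _)
  · simp [h0 t ht]

lemma deriv_eq_zero_of_locally_const {f : ℝ → ℝ} {a : ℝ} {s : Set ℝ} (hs : IsOpen s)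
    (h : ∀ t ∈ s, f t = a) {t : ℝ} (ht : t ∈ s) : deriv f t = 0 := by
  have : f =ᶠ[𝓝 t] fun _ => a := by
    filter_upwards [hs.mem_nhds ht] with u hu using h u hu
  rw [this.deriv_eq, deriv_const]

/-- `g` decreases from `1` to `0` on `[0, 1]`, with successive derivatives `g₁`, `g₂`, `g₃` bounded
by `G`. -/
structure IsSmoothStep (g g₁ g₂ g₃ : ℝ → ℝ) (G : ℝ) : Prop where
  hasDerivAt : ∀ t, HasDerivAt g (g₁ t) t
  hasDerivAt₁ : ∀ t, HasDerivAt g₁ (g₂ t) t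
  hasDerivAt₂ : ∀ t, HasDerivAt g₂ (g₃ t) t
  abs_le₁ : ∀ t, |g₁ t| ≤ G
  abs_le₂ : ∀ t, |g₂ t| ≤ G
  abs_le₃ : ∀ t, |g₃ t| ≤ G
  nonneg : ∀ t, 0 ≤ g t
  le_one : ∀ t, g t ≤ 1
  eq_one : ∀ t, t ≤ 0 → g t = 1
  eq_zero : ∀ t, 1 ≤ t → g t = 0

lemma exists_isSmoothStep : ∃ (g g₁ g₂ g₃ : ℝ → ℝ) (G : ℝ), IsSmoothStep g g₁ g₂ g₃ G := by
  let g : ℝ → ℝ := fun t => 1 - Real.smoothTransition t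
  have hg : ContDiff ℝ 3 g := contDiff_const.sub Real.smoothTransition.contDiff
  have hg1 : ContDiff ℝ 2 (deriv g) := by
    have : ContDiff ℝ (2 + 1) g := hg.of_le (by norm_num)
    exact (contDiff_succ_iff_deriv.1 this).2.2
  have hg2 : ContDiff ℝ 1 (deriv (deriv g)) := by
    have : ContDiff ℝ (1 + 1) (deriv g) := hg1.of_le (by norm_num)
    exact (contDiff_succ_iff_deriv.1 this).2.2
  have hg3 : ContDiff ℝ 0 (deriv (deriv (deriv g))) := by
    have : ContDiff ℝ (0 + 1) (deriv (deriv g)) := hg2.of_le (by norm_num)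
    exact (contDiff_succ_iff_deriv.1 this).2.2
  have hs : IsOpen (Icc (0 : ℝ) 1)ᶜ := isClosed_Icc.isOpen_compl
  have hone : ∀ t : ℝ, t ≤ 0 → g t = 1 := fun t ht => by
    simp [g, Real.smoothTransition.zero_of_nonpos ht]
  have hzero : ∀ t : ℝ, 1 ≤ t → g t = 0 := fun t ht => by
    simp [g, Real.smoothTransition.one_of_one_le ht]
  have z1 : ∀ t, t ∉ Icc (0 : ℝ) 1 → deriv g t = 0 := by
    intro t ht
    rcases lt_or_ge t 0 with h | h
    · exact deriv_eq_zero_of_locally_const isOpen_Iio (fun u hu => hone u (le_of_lt hu)) h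
    · have : 1 < t := by
        by_contra h'
        exact ht ⟨h, not_lt.1 h'⟩
      exact deriv_eq_zero_of_locally_const isOpen_Ioi (fun u hu => hzero u (le_of_lt hu)) this
  have z2 : ∀ t, t ∉ Icc (0 : ℝ) 1 → deriv (deriv g) t = 0 := fun t ht =>
    deriv_eq_zero_of_locally_const hs (fun u hu => z1 u hu) ht
  have z3 : ∀ t, t ∉ Icc (0 : ℝ) 1 → deriv (deriv (deriv g)) t = 0 := fun t ht =>
    deriv_eq_zero_of_locally_const hs (fun u hu => z2 u hu) ht
  obtain ⟨G1, hG1⟩ := exists_abs_le_of_continuous_of_zero hg1.continuous z1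
  obtain ⟨G2, hG2⟩ := exists_abs_le_of_continuous_of_zero hg2.continuous z2
  obtain ⟨G3, hG3⟩ := exists_abs_le_of_continuous_of_zero hg3.continuous z3
  refine ⟨g, deriv g, deriv (deriv g), deriv (deriv (deriv g)), max G1 (max G2 G3),
    fun t => (hg.differentiable (by norm_num) t).hasDerivAt,
    fun t => (hg1.differentiable (by norm_num) t).hasDerivAt,
    fun t => (hg2.differentiable (by norm_num) t).hasDerivAt,
    fun t => (hG1 t).trans (le_max_left _ _),
    fun t => (hG2 t).trans ((le_max_left _ _).trans (le_max_right _ _)),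
    fun t => (hG3 t).trans ((le_max_right _ _).trans (le_max_right _ _)),
    fun t => sub_nonneg.2 (Real.smoothTransition.le_one t),
    fun t => sub_le_self _ (Real.smoothTransition.nonneg t), hone, hzero⟩

section Comparison

variable [Nonempty ι] {g g₁ g₂ g₃ : ℝ → ℝ} {G : ℝ} (hg : IsSmoothStep g g₁ g₂ g₃ G)
  (P Q : Measure (ι → ℝ)) [IsGaussian P] [IsGaussian Q]
  (hP : ∀ j, ∫ x, x j ∂P = 0) (hQ : ∀ j, ∫ x, x j ∂Q = 0) {Δ : ℝ}
  (hΔ : ∀ j k, |∫ x, x j * x k ∂P - ∫ x, x j * x k ∂Q| ≤ Δ)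

include hg

lemma continuous_smoothStep_softMax (β δ : ℝ) (c : ι → ℝ) :
    Continuous fun x => g (δ⁻¹ * softMax β c x) :=
  (continuous_iff_continuousAt.2 fun t => (hg.hasDerivAt t).continuousAt).comp
    (continuous_const.mul (continuous_softMax β c))

lemma integrable_smoothStep_softMax (β δ : ℝ) (c : ι → ℝ) :
    Integrable (fun x => g (δ⁻¹ * softMax β c x)) P :=
  .of_bound (continuous_smoothStep_softMax hg β δ c).aestronglyMeasurable 1
    (Eventually.of_forall fun x => by
      rw [Real.norm_eq_abs, abs_of_nonneg (hg.nonneg _)]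
      exact hg.le_one _)

include hP hQ hΔ

lemma abs_integral_smoothStep_sub_le (hΔ0 : 0 ≤ Δ) (c : ι → ℝ) {β δ : ℝ} (hβ : 0 < β)
    (hδ : 0 < δ) :
    |∫ x, g (δ⁻¹ * softMax β c x) ∂P - ∫ x, g (δ⁻¹ * softMax β c x) ∂Q|
      ≤ (δ⁻¹ ^ 2 * G + 2 * β * (δ⁻¹ * G)) * Δ / 2 := by
  classical
  have hG0 : 0 ≤ G := (abs_nonneg _).trans (hg.abs_le₁ 0)
  have hδ' : 0 < δ⁻¹ := inv_pos.2 hδ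
  have hlin : ∀ t : ℝ, HasDerivAt (fun t => δ⁻¹ * t) δ⁻¹ t := fun t =>
    ((hasDerivAt_id t).const_mul δ⁻¹).congr_deriv (mul_one _)
  have hd : ∀ {f f' : ℝ → ℝ} (n : ℕ), (∀ t, HasDerivAt f (f' t) t) → ∀ t,
      HasDerivAt (fun t => δ⁻¹ ^ n * f (δ⁻¹ * t)) (δ⁻¹ ^ (n + 1) * f' (δ⁻¹ * t)) t := by
    intro f f' n h t
    refine (((h (δ⁻¹ * t)).comp t (hlin t)).const_mul (δ⁻¹ ^ n)).congr_deriv ?_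
    ring
  have hb : ∀ {f : ℝ → ℝ} (n : ℕ), (∀ t, |f t| ≤ G) → ∀ t,
      |δ⁻¹ ^ n * f (δ⁻¹ * t)| ≤ δ⁻¹ ^ n * G := by
    intro f n h t
    rw [abs_mul, abs_of_pos (by positivity)]
    exact mul_le_mul_of_nonneg_left (h _) (by positivity)
  have hpos : ∀ n : ℕ, 0 ≤ δ⁻¹ ^ n * G := fun n => by positivity
  refine abs_integral_sub_integral_le P Q hP hQ hΔ (continuous_smoothStep_softMax hg β δ c)
    (b := 1) (fun x => ?_)
    (D := fun w j => δ⁻¹ ^ 1 * g₁ (δ⁻¹ * softMax β c w) * gibbs β c w j)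
    (H := fun w => softHessian β c (δ⁻¹ ^ 1 * g₁ (δ⁻¹ * softMax β c w))
      (δ⁻¹ ^ 2 * g₂ (δ⁻¹ * softMax β c w)) w)
    (C := (δ⁻¹ ^ 1 * G + δ⁻¹ ^ 2 * G + δ⁻¹ ^ 3 * G) * (1 + 6 * β + 6 * β ^ 2))
    (fun w => ?_) (fun w x => ?_) hΔ0
  · rw [abs_of_nonneg (hg.nonneg _)]
    exact hg.le_one _
  · refine (sum_abs_softHessian_le c hβ _ _ w).trans ?_
    gcongr
    · exact hb 2 hg.abs_le₂ _
    · simpa using hb 1 hg.abs_le₁ (softMax β c w)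
  · have := softMax_taylor c hβ (g := fun t => δ⁻¹ ^ 0 * g (δ⁻¹ * t)) (hd 0 hg.hasDerivAt)
      (hd 1 hg.hasDerivAt₁) (hd 2 hg.hasDerivAt₂)
      (G := δ⁻¹ ^ 1 * G + δ⁻¹ ^ 2 * G + δ⁻¹ ^ 3 * G)
      (fun t => (hb 1 hg.abs_le₁ t).trans (by linarith [hpos 2, hpos 3]))
      (fun t => (hb 2 hg.abs_le₂ t).trans (by linarith [hpos 1, hpos 3]))
      (fun t => (hb 3 hg.abs_le₃ t).trans (by linarith [hpos 1, hpos 2])) w x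
    simpa only [pow_zero, one_mul, zero_add] using this

lemma measureReal_orthant_le (hΔ0 : 0 ≤ Δ) (c : ι → ℝ) {β δ : ℝ} (hβ : 0 < β) (hδ : 0 < δ)
    (hcard : Real.log (Fintype.card ι) ≤ β * δ) :
    P.real {x | ∀ j, x j ≤ c j} ≤ Q.real {x | ∀ j, x j ≤ c j + 2 * δ}
      + (δ⁻¹ ^ 2 * G + 2 * β * (δ⁻¹ * G)) * Δ / 2 := by
  set c' : ι → ℝ := fun j => c j + δ with hc'
  have hmeas : ∀ d : ι → ℝ, MeasurableSet {x : ι → ℝ | ∀ j, x j ≤ d j} := fun d =>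
    (isClosed_le continuous_id continuous_const : IsClosed {x : ι → ℝ | x ≤ d}).measurableSet
  have hind : ∀ (N : Measure (ι → ℝ)) [IsGaussian N] (d : ι → ℝ),
      N.real {x | ∀ j, x j ≤ d j} =
        ∫ x, {x : ι → ℝ | ∀ j, x j ≤ d j}.indicator (1 : (ι → ℝ) → ℝ) x ∂N :=
    fun N _ d => (integral_indicator_one (hmeas d)).symm
  have hintegrable : ∀ (N : Measure (ι → ℝ)) [IsGaussian N] (d : ι → ℝ),
      Integrable ({x : ι → ℝ | ∀ j, x j ≤ d j}.indicator (1 : (ι → ℝ) → ℝ)) N :=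
    fun N _ d => (integrable_const (1 : ℝ)).indicator (hmeas d)
  have h1 : P.real {x | ∀ j, x j ≤ c j} ≤ ∫ x, g (δ⁻¹ * softMax β c' x) ∂P := by
    rw [hind]
    refine integral_mono (hintegrable P c) (integrable_smoothStep_softMax hg P β δ c') fun x => ?_
    refine indicator_apply_le' (fun hx => ?_) fun _ => hg.nonneg _
    refine (hg.eq_one _ ?_).ge
    refine mul_nonpos_of_nonneg_of_nonpos (inv_pos.2 hδ).le ?_
    have h := softMax_le c' hβ (w := x) (t := -δ) fun j => by
      have := hx j
      simp only [hc']
      linarith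
    have h' : Real.log (Fintype.card ι) / β ≤ δ := by
      rw [div_le_iff₀ hβ]
      linarith
    linarith
  have h2 : ∫ x, g (δ⁻¹ * softMax β c' x) ∂Q ≤ Q.real {x | ∀ j, x j ≤ c j + 2 * δ} := by
    rw [hind Q fun j => c j + 2 * δ]
    refine integral_mono (integrable_smoothStep_softMax hg Q β δ c') (hintegrable Q _) fun x => ?_
    by_cases hx : ∀ j, x j ≤ c j + 2 * δ
    · rw [indicator_of_mem (by exact hx)]
      exact hg.le_one _
    · rw [indicator_of_notMem (by exact hx)]
      refine (hg.eq_zero _ ?_).le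
      push Not at hx
      obtain ⟨j, hj⟩ := hx
      have := le_softMax c' hβ x j
      simp only [hc'] at this
      rw [inv_mul_eq_div, le_div_iff₀ hδ]
      linarith
  have h3 := abs_integral_smoothStep_sub_le hg P Q hP hQ hΔ hΔ0 c' hβ hδ
  linarith [le_abs_self (∫ x, g (δ⁻¹ * softMax β c' x) ∂P - ∫ x, g (δ⁻¹ * softMax β c' x) ∂Q)]

/-- Comparison of two Gaussian measures on an orthant, with a free smoothing parameter `δ`. -/
lemma abs_measureReal_orthant_sub_le (hΔ0 : 0 ≤ Δ) {s : ℝ} (hs : 0 < s)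
    (hvar : ∀ j, s ^ 2 ≤ ∫ x, x j * x j ∂Q) (c : ι → ℝ) {δ Λ : ℝ} (hδ : 0 < δ) (hΛ : 1 ≤ Λ)
    (hcard : Real.log (Fintype.card ι) ≤ Λ) :
    |P.real {x | ∀ j, x j ≤ c j} - Q.real {x | ∀ j, x j ≤ c j}|
      ≤ 2 * G * (Λ * Δ / δ ^ 2) + 12 * Real.exp 2 * (√Λ * δ / s) := by
  have hG0 : 0 ≤ G := (abs_nonneg _).trans (hg.abs_le₁ 0)
  have hβ : 0 < Λ / δ := by positivity
  have hβδ : Real.log (Fintype.card ι) ≤ Λ / δ * δ := by rwa [div_mul_cancel₀ _ hδ.ne']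
  have hL : 1 ≤ √(2 * Λ) := by
    rw [Real.one_le_sqrt]
    linarith
  have hcard' : (Fintype.card ι : ℝ) ≤ Real.exp (√(2 * Λ) ^ 2 / 2) := by
    rw [Real.sq_sqrt (by linarith), mul_div_cancel_left₀ _ two_ne_zero]
    exact (Real.log_le_iff_le_exp (by exact_mod_cast Fintype.card_pos)).1 hcard
  have hsq : 1 + √(2 * Λ) ≤ 3 * √Λ := by
    rw [Real.sqrt_mul zero_le_two]
    have h1 : 1 ≤ √Λ := Real.one_le_sqrt.2 hΛ
    have h2 : √2 ≤ 2 := by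
      rw [Real.sqrt_le_left (by norm_num)]
      norm_num
    nlinarith
  have hanti : ∀ d : ι → ℝ, Q.real {x | ∀ j, x j ≤ d j + 2 * δ} ≤
      Q.real {x | ∀ j, x j ≤ d j} + 12 * Real.exp 2 * (√Λ * δ / s) := fun d => by
    refine (anticoncentration Q hQ hs hvar d hL (by positivity : 0 ≤ 2 * δ) hcard').trans ?_
    have : 2 * Real.exp 2 * (1 + √(2 * Λ)) * (2 * δ / s)
        ≤ 2 * Real.exp 2 * (3 * √Λ) * (2 * δ / s) := by gcongr
    refine (add_le_add_right this _).trans (le_of_eq ?_)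
    ring
  have herr : (δ⁻¹ ^ 2 * G + 2 * (Λ / δ) * (δ⁻¹ * G)) * Δ / 2 ≤ 2 * G * (Λ * Δ / δ ^ 2) := by
    have h1 : (δ⁻¹ ^ 2 * G + 2 * (Λ / δ) * (δ⁻¹ * G)) * Δ / 2
        = (1 + 2 * Λ) / 2 * (G * (Δ / δ ^ 2)) := by
      field_simp
    have h2 : 2 * G * (Λ * Δ / δ ^ 2) = 2 * Λ * (G * (Δ / δ ^ 2)) := by ring
    rw [h1, h2]
    exact mul_le_mul_of_nonneg_right (by linarith) (by positivity)
  have hup := measureReal_orthant_le hg P Q hP hQ hΔ hΔ0 c hβ hδ hβδ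
  have hlow := measureReal_orthant_le hg Q P hQ hP (fun j k => by rw [abs_sub_comm]; exact hΔ j k)
    hΔ0 (fun j => c j - 2 * δ) hβ hδ hβδ
  have hanti' := hanti fun j => c j - 2 * δ
  simp only [sub_add_cancel] at hlow hanti'
  rw [abs_le]
  constructor <;> linarith [hanti c]

/-- Comparison of two Gaussian measures on an orthant. -/
lemma abs_measureReal_orthant_sub_le_rpow (hΔ0 : 0 ≤ Δ) {s : ℝ} (hs : 0 < s)
    (hvar : ∀ j, s ^ 2 ≤ ∫ x, x j * x j ∂Q) (c : ι → ℝ) {Λ : ℝ} (hΛ : 1 ≤ Λ)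
    (hcard : Real.log (Fintype.card ι) ≤ Λ) :
    |P.real {x | ∀ j, x j ≤ c j} - Q.real {x | ∀ j, x j ≤ c j}|
      ≤ (2 * G + 12 * Real.exp 2 / s) * Δ ^ ((1 : ℝ) / 3) * Λ ^ ((2 : ℝ) / 3) := by
  have hbound := fun δ (hδ : 0 < δ) =>
    abs_measureReal_orthant_sub_le hg P Q hP hQ hΔ hΔ0 hs hvar c hδ hΛ hcard
  have hΛ0 : 0 < Λ := by linarith
  rcases hΔ0.eq_or_lt with rfl | hΔpos
  · have hlim : Tendsto (fun δ : ℝ => 2 * G * (Λ * 0 / δ ^ 2) + 12 * Real.exp 2 * (√Λ * δ / s))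
        (𝓝[>] 0) (𝓝 0) := by
      have : Tendsto (fun δ : ℝ => 12 * Real.exp 2 * (√Λ * δ / s)) (𝓝 0)
          (𝓝 (12 * Real.exp 2 * (√Λ * 0 / s))) := Continuous.tendsto (by fun_prop) 0
      simpa using this.mono_left nhdsWithin_le_nhds
    rw [Real.zero_rpow (by norm_num), mul_zero, zero_mul]
    exact ge_of_tendsto hlim (eventually_mem_nhdsWithin.mono fun δ hδ => hbound δ hδ)
  · set d := Δ ^ ((1 : ℝ) / 3) with hd
    set l := Λ ^ ((1 : ℝ) / 6) with hl
    have hd0 : 0 < d := by positivity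
    have hl0 : 0 < l := by positivity
    have hd3 : Δ = d ^ 3 := by
      rw [hd, ← Real.rpow_natCast, ← Real.rpow_mul hΔ0]
      norm_num
    have hl6 : Λ = l ^ 6 := by
      rw [hl, ← Real.rpow_natCast, ← Real.rpow_mul hΛ0.le]
      norm_num
    have hl4 : Λ ^ ((2 : ℝ) / 3) = l ^ 4 := by
      rw [hl, ← Real.rpow_natCast, ← Real.rpow_mul hΛ0.le]
      norm_num
    have hl3 : √Λ = l ^ 3 := by
      rw [hl6, show l ^ 6 = (l ^ 3) ^ 2 by ring, Real.sqrt_sq (by positivity)]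
    refine (hbound (d * l) (by positivity)).trans (le_of_eq ?_)
    rw [hl4, hl3, hl6, hd3]
    field_simp

end Comparison

section Rectangle

variable {Ω : Type*} [MeasurableSpace Ω] {μ : Measure Ω} {p : ℕ} {X : Ω → Fin p → ℝ}

/-- The vector of signed coordinates `σ i * x (e i)`. -/
def signedCoord (e : ι → Fin p) (σ : ι → ℝ) (x : Fin p → ℝ) (i : ι) : ℝ := σ i * x (e i)

omit [Fintype ι] in
lemma IsCenteredGaussianVec.measurable_signedCoord (hX : IsCenteredGaussianVec μ X)
    (e : ι → Fin p) (σ : ι → ℝ) : Measurable fun ω => signedCoord e σ (X ω) := by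
  have := hX.1
  unfold signedCoord
  fun_prop

lemma IsCenteredGaussianVec.isGaussian_map (hX : IsCenteredGaussianVec μ X) (e : ι → Fin p)
    (σ : ι → ℝ) : IsGaussian (μ.map fun ω => signedCoord e σ (X ω)) := by
  classical
  refine isGaussian_of_map_eq_gaussianReal fun L => ?_
  obtain ⟨v, hv⟩ := hX.2.2 fun j => ∑ i, if e i = j then L (Pi.single i 1) * σ i else 0
  refine ⟨0, v, ?_⟩
  rw [← hv, Measure.map_map L.continuous.measurable (hX.measurable_signedCoord e σ)]
  congr 1
  ext ω
  have hL : ∀ y : ι → ℝ, L y = ∑ i, L (Pi.single i 1) * y i := fun y => by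
    conv_lhs => rw [pi_eq_sum_univ' y, map_sum]
    refine Finset.sum_congr rfl fun i _ => ?_
    rw [map_smul, smul_eq_mul, mul_comm]
  rw [Function.comp_apply, hL]
  simp only [Finset.sum_mul]
  rw [Finset.sum_comm]
  refine Finset.sum_congr rfl fun i _ => ?_
  simp [signedCoord, ite_mul, mul_assoc]

omit [Fintype ι] in
lemma integral_map_signedCoord (hX : IsCenteredGaussianVec μ X) (e : ι → Fin p) (σ : ι → ℝ)
    (i : ι) : ∫ y, y i ∂(μ.map fun ω => signedCoord e σ (X ω)) = 0 := by
  rw [integral_map (hX.measurable_signedCoord e σ).aemeasurable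
    (measurable_pi_apply i).aestronglyMeasurable]
  simp only [signedCoord]
  rw [integral_const_mul, hX.2.1, mul_zero]

lemma integral_mul_map_signedCoord (hX : IsCenteredGaussianVec μ X) (e : ι → Fin p) (σ : ι → ℝ)
    (i k : ι) : ∫ y, y i * y k ∂(μ.map fun ω => signedCoord e σ (X ω))
      = σ i * σ k * ∫ ω, X ω (e i) * X ω (e k) ∂μ := by
  rw [integral_map (hX.measurable_signedCoord e σ).aemeasurable
    (by fun_prop),
    ← integral_const_mul]
  simp only [signedCoord]
  congr with ω
  ring

lemma measureReal_map_signedCoord (hX : IsCenteredGaussianVec μ X) (e : ι → Fin p) (σ c : ι → ℝ) :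
    (μ.map fun ω => signedCoord e σ (X ω)).real {y | ∀ i, y i ≤ c i}
      = μ.real {ω | ∀ i, σ i * X ω (e i) ≤ c i} :=
  map_measureReal_apply (hX.measurable_signedCoord e σ)
    (isClosed_le continuous_id continuous_const : IsClosed {y : ι → ℝ | y ≤ c}).measurableSet

lemma abs_measureReal_signed_orthant_sub_le {g g₁ g₂ g₃ : ℝ → ℝ} {G : ℝ}
    (hg : IsSmoothStep g g₁ g₂ g₃ G) {Ω' : Type*} [MeasurableSpace Ω'] {ν : Measure Ω'}
    {Y : Ω' → Fin p → ℝ} [IsProbabilityMeasure μ] [IsProbabilityMeasure ν]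
    (hX : IsCenteredGaussianVec μ X) (hY : IsCenteredGaussianVec ν Y) {Δ : ℝ} (hΔ0 : 0 ≤ Δ)
    (hΔ : ∀ j k, |∫ ω, X ω j * X ω k ∂μ - ∫ ω, Y ω j * Y ω k ∂ν| ≤ Δ) {s : ℝ} (hs : 0 < s)
    (hvar : ∀ j, s ^ 2 ≤ ∫ ω, Y ω j * Y ω j ∂ν) (e : ι → Fin p) {σ : ι → ℝ}
    (hσ : ∀ i, |σ i| = 1) (c : ι → ℝ) {Λ : ℝ} (hΛ : 1 ≤ Λ)
    (hcard : Real.log (Fintype.card ι) ≤ Λ) :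
    |μ.real {ω | ∀ i, σ i * X ω (e i) ≤ c i} - ν.real {ω | ∀ i, σ i * Y ω (e i) ≤ c i}|
      ≤ (2 * G + 12 * Real.exp 2 / s) * Δ ^ ((1 : ℝ) / 3) * Λ ^ ((2 : ℝ) / 3) := by
  rcases isEmpty_or_nonempty ι with hι | hι
  · have hG0 : 0 ≤ G := (abs_nonneg _).trans (hg.abs_le₁ 0)
    have hΛ0 : 0 ≤ Λ := by linarith
    simp only [IsEmpty.forall_iff, ofPred_true, probReal_univ, sub_self, abs_zero]
    positivity
  · have := hX.isGaussian_map e σ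
    have := hY.isGaussian_map e σ
    rw [← measureReal_map_signedCoord hX, ← measureReal_map_signedCoord hY]
    refine abs_measureReal_orthant_sub_le_rpow hg _ _ (integral_map_signedCoord hX e σ)
      (integral_map_signedCoord hY e σ) (fun i k => ?_) hΔ0 hs (fun i => ?_) c hΛ hcard
    · rw [integral_mul_map_signedCoord hX, integral_mul_map_signedCoord hY, ← mul_sub, abs_mul,
        abs_mul, hσ, hσ, one_mul, one_mul]
      exact hΔ _ _
    · rw [integral_mul_map_signedCoord hY, ← abs_mul_abs_self, hσ, one_mul, one_mul]
      exact hvar _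

end Rectangle

lemma coe_le_iff_of_ne_bot {b : EReal} (hb : b ≠ ⊥) (x : ℝ) :
    (x : EReal) ≤ b ↔ (b ≠ ⊤ → x ≤ b.toReal) := by
  induction b <;> simp_all

lemma le_coe_iff_of_ne_top {a : EReal} (ha : a ≠ ⊤) (x : ℝ) :
    a ≤ (x : EReal) ↔ (a ≠ ⊥ → a.toReal ≤ x) := by
  induction a <;> simp_all

/-- The finite constraints of the rectangle with corners `a` and `b`: the upper bounds are the
pairs `(j, true)` and the lower bounds the pairs `(j, false)`. -/
abbrev FiniteFace {p : ℕ} (a b : Fin p → EReal) : Type :=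
  {i : Fin p × Bool // (i.2 = true → b i.1 ≠ ⊤) ∧ (i.2 = false → a i.1 ≠ ⊥)}

lemma forall_mem_rectangle_iff {p : ℕ} {a b : Fin p → EReal} (ha : ∀ j, a j ≠ ⊤)
    (hb : ∀ j, b j ≠ ⊥) (x : Fin p → ℝ) :
    (∀ j, a j ≤ (x j : EReal) ∧ (x j : EReal) ≤ b j) ↔
      ∀ i : FiniteFace a b, (if i.1.2 then (1 : ℝ) else -1) * x i.1.1
        ≤ if i.1.2 then (b i.1.1).toReal else -(a i.1.1).toReal := by
  simp only [coe_le_iff_of_ne_bot (hb _), le_coe_iff_of_ne_top (ha _), Subtype.forall, Prod.forall,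
    Bool.forall_bool]
  simp [and_comm]

lemma log_card_finiteFace_le {p : ℕ} (hp : 3 ≤ p) (a b : Fin p → EReal) [Fintype (FiniteFace a b)] :
    Real.log (Fintype.card (FiniteFace a b)) ≤ 2 * Real.log p := by
  have h1 : Fintype.card (FiniteFace a b) ≤ p ^ 2 :=
    calc Fintype.card (FiniteFace a b) ≤ Fintype.card (Fin p × Bool) :=
          Fintype.card_subtype_le _
      _ = p * 2 := by simp
      _ ≤ p ^ 2 := by nlinarith
  rcases Nat.eq_zero_or_pos (Fintype.card (FiniteFace a b)) with h0 | h0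
  · rw [h0, Nat.cast_zero, Real.log_zero]
    have := Real.log_natCast_nonneg p
    linarith
  · have h2 : (Fintype.card (FiniteFace a b) : ℝ) ≤ (p : ℝ) ^ 2 := by exact_mod_cast h1
    refine (Real.log_le_log (by exact_mod_cast h0) h2).trans (le_of_eq ?_)
    rw [Real.log_pow]
    norm_num

lemma one_le_log_natCast {p : ℕ} (hp : 3 ≤ p) : 1 ≤ Real.log p := by
  have h3 : (3 : ℝ) ≤ p := by exact_mod_cast hp
  rw [Real.le_log_iff_exp_le (by linarith)]
  linarith [Real.exp_one_lt_d9]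

/-- Proposition: Gaussian comparison on hyperrectangles.  There is a
constant `K` depending only on `min_j σ^Y_{jj}` such that for centered Gaussian vectors
`X`, `Y` of dimension `p ≥ 3` with `σ^Y_{jj} > 0`,
`sup_{A∈𝒜^{Re}} |P(X∈A) − P(Y∈A)| ≤ K Δ^{1/3} log^{2/3} p` with
`Δ = max_{j,k} |σ^X_{jk} − σ^Y_{jk}|`. -/
theorem statement16 :
    ∃ K : ℝ → ℝ, ∀ (p : ℕ), 3 ≤ p →
      ∀ (Ω₁ Ω₂ : Type) (mΩ₁ : MeasurableSpace Ω₁) (mΩ₂ : MeasurableSpace Ω₂)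
        (μ : Measure Ω₁) (ν : Measure Ω₂),
        IsProbabilityMeasure μ → IsProbabilityMeasure ν →
      ∀ (X : Ω₁ → Fin p → ℝ) (Y : Ω₂ → Fin p → ℝ),
        IsCenteredGaussianVec μ X → IsCenteredGaussianVec ν Y →
        (∀ j, 0 < ∫ ω, Y ω j * Y ω j ∂ν) →
        ∀ a b : Fin p → EReal,
          |(μ {ω | ∀ j, a j ≤ (X ω j : EReal) ∧ (X ω j : EReal) ≤ b j}).toReal
            - (ν {ω | ∀ j, a j ≤ (Y ω j : EReal) ∧ (Y ω j : EReal) ≤ b j}).toReal|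
          ≤ K (⨅ j, ∫ ω, Y ω j * Y ω j ∂ν)
              * (⨆ j, ⨆ l, |(∫ ω, X ω j * X ω l ∂μ) - ∫ ω, Y ω j * Y ω l ∂ν|) ^ ((1 : ℝ) / 3)
              * Real.log p ^ ((2 : ℝ) / 3) := by
  classical
  obtain ⟨g, g₁, g₂, g₃, G, hg⟩ := exists_isSmoothStep
  have hG0 : 0 ≤ G := (abs_nonneg _).trans (hg.abs_le₁ 0)
  refine ⟨fun v => (2 * G + 12 * Real.exp 2 / √v) * 2 ^ ((2 : ℝ) / 3), ?_⟩
  intro p hp Ω₁ Ω₂ _ _ μ ν _ _ X Y hX hY hvar a b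
  have : Nonempty (Fin p) := ⟨⟨0, by omega⟩⟩
  set Δ := ⨆ j, ⨆ l, |(∫ ω, X ω j * X ω l ∂μ) - ∫ ω, Y ω j * Y ω l ∂ν|
  have hΔ : ∀ j l, |(∫ ω, X ω j * X ω l ∂μ) - ∫ ω, Y ω j * Y ω l ∂ν| ≤ Δ := fun j l =>
    (le_ciSup (f := fun l => |(∫ ω, X ω j * X ω l ∂μ) - ∫ ω, Y ω j * Y ω l ∂ν|)
      (finite_range _).bddAbove l).trans
      (le_ciSup (f := fun j => ⨆ l, |(∫ ω, X ω j * X ω l ∂μ) - ∫ ω, Y ω j * Y ω l ∂ν|)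
        (finite_range _).bddAbove j)
  have hΔ0 : 0 ≤ Δ := (abs_nonneg _).trans (hΔ (Classical.arbitrary _) (Classical.arbitrary _))
  set v := ⨅ j, ∫ ω, Y ω j * Y ω j ∂ν with hv
  have hv0 : 0 < v := by
    obtain ⟨j, hj⟩ := exists_eq_ciInf_of_finite (f := fun j => ∫ ω, Y ω j * Y ω j ∂ν)
    rw [hv, ← hj]
    exact hvar j
  have hlog := one_le_log_natCast hp
  by_cases hab : (∀ j, a j ≠ ⊤) ∧ ∀ j, b j ≠ ⊥
  · simp only [forall_mem_rectangle_iff hab.1 hab.2]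
    refine (abs_measureReal_signed_orthant_sub_le hg hX hY hΔ0 hΔ (Real.sqrt_pos.2 hv0)
      (fun j => ?_) (fun i : FiniteFace a b => i.1.1)
      (σ := fun i => if i.1.2 then (1 : ℝ) else -1) (fun i => ?_) _
      (by linarith : 1 ≤ 2 * Real.log p) (log_card_finiteFace_le hp a b)).trans (le_of_eq ?_)
    · rw [Real.sq_sqrt hv0.le]
      exact ciInf_le (finite_range _).bddBelow j
    · split_ifs <;> simp
    · rw [Real.mul_rpow zero_le_two (by linarith)]
      ring
  · have hempty : ∀ x : Fin p → ℝ, ¬ ∀ j, a j ≤ (x j : EReal) ∧ (x j : EReal) ≤ b j := by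
      intro x hx
      refine hab ⟨fun j hj => ?_, fun j hj => ?_⟩
      · simpa [hj] using (hx j).1
      · simpa [hj] using (hx j).2
    simp only [hempty, ofPred_false, measure_empty, sub_self, abs_zero]
    have : 0 ≤ Real.log p := by linarith
    positivity

end AJDN
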